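/- For every real κ ≥ 1, every integer k ≥ 1 and every y = (y₁,…,y_k) ∈ [0,∞)^k, lim_{n→∞} ∫₀^∞ |R_β⁽ⁿ⁾(γₙ t, k, y) − (1/σ)(Σ_{j=1}^k y_j) exp(−((b+m)/(σλ) + β) t)|^{2κ} dt = 0. -/

import Mathlib

open MeasureTheory Filter Set

noncomputable def convIter (f : ℝ → ℝ) : ℕ → ℝ → ℝ
  | 0 => f
  | (k + 1) => fun t => ∫ s in (0:ℝ)..t, convIter f k (t - s) * f s

noncomputable def resolventFn (a : ℝ) (f : ℝ → ℝ) (t : ℝ) : ℝ :=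
  ∑' k : ℕ, a ^ (k + 1) * convIter f k t

noncomputable def resolventK (lamn γn β : ℝ) (R : ℝ → ℝ) {k : ℕ}
    (y : Fin k → ℝ) (t : ℝ) : ℝ :=
  lamn * Real.exp (-(β * t) / γn) * (∑ j, if t < y j then (1:ℝ) else 0)
    + lamn * ∫ s in (0:ℝ)..t,
        (R (t - s) * Real.exp (-(β * s) / γn) * (∑ j, if s < y j then (1:ℝ) else 0))


open scoped FourierTransform SchwartzMap ContDiff in
theorem aux_plancherel (f : ℝ → ℂ) (hf : Integrable f) (hf2 : MemLp f 2) :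
    ∫ t, ‖f t‖ ^ 2 = ∫ w, ‖𝓕 f w‖ ^ 2 := by
  set g : Lp ℂ 2 (volume : Measure ℝ) := hf2.toLp f with hg
  have hgf : (g : ℝ → ℂ) =ᵐ[volume] f := hf2.coeFn_toLp
  have hcont : Continuous (𝓕 f) :=
    VectorFourier.fourierIntegral_continuous Real.continuous_fourierChar
      (by exact continuous_inner) hf
  have key : ((𝓕 g : Lp ℂ 2 (volume : Measure ℝ)) : ℝ → ℂ) =ᵐ[volume] 𝓕 f := by
    apply ae_eq_of_integral_contDiff_smul_eq
    · exact (Lp.memLp _).locallyIntegrable (by norm_num)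
    · exact hcont.locallyIntegrable
    intro φ hφ hφc
    have hg₁ : HasCompactSupport (Complex.ofRealCLM ∘ φ) := hφc.comp_left rfl
    have hg₂ : ContDiff ℝ ∞ (Complex.ofRealCLM ∘ φ) := by fun_prop
    set ψ : 𝓢(ℝ, ℂ) := hg₁.toSchwartzMap hg₂ with hψ
    have e1 : ∫ x, φ x • (𝓕 g : Lp ℂ 2 (volume : Measure ℝ)) x
        = (((𝓕 g : Lp ℂ 2 (volume : Measure ℝ))) : 𝓢'(ℝ, ℂ)) ψ := by
      rw [Lp.toTemperedDistribution_apply]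
      simp [hψ]
    rw [e1, ← Lp.fourier_toTemperedDistribution_eq, TemperedDistribution.fourier_apply,
      Lp.toTemperedDistribution_apply]
    have e2 : ∫ x, (𝓕 ψ) x • g x = ∫ x, (𝓕 (ψ : ℝ → ℂ)) x • f x := by
      apply integral_congr_ae
      filter_upwards [hgf] with x hx
      rw [hx, SchwartzMap.fourier_coe]
    rw [e2]
    have := VectorFourier.integral_fourierIntegral_smul_eq_flip (L := innerₗ ℝ) (μ := (volume : Measure ℝ)) (ν := (volume : Measure ℝ)) (f := (ψ : ℝ → ℂ)) (g := f)
      Real.continuous_fourierChar (by exact continuous_inner) ψ.integrable hf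
    rw [flip_innerₗ] at this
    refine Eq.trans ?_ (this.trans ?_)
    · rfl
    · apply integral_congr_ae
      filter_upwards with x
      have hx : ψ x = ((φ x : ℝ) : ℂ) := rfl
      rw [hx, Complex.coe_smul]
      rfl
  have h0 : ∀ g : Lp ℂ 2 (volume : Measure ℝ), ‖g‖ ^ 2 = ∫ t, ‖g t‖ ^ 2 := by
    intro g
    rw [← real_inner_self_eq_norm_sq, L2.inner_def]
    simp only [real_inner_self_eq_norm_sq]
  have h1 : ‖g‖ ^ 2 = ∫ t, ‖f t‖ ^ 2 := by
    rw [h0]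
    apply integral_congr_ae
    filter_upwards [hgf] with x hx
    rw [hx]
  have h2 : ‖𝓕 g‖ ^ 2 = ∫ w, ‖𝓕 f w‖ ^ 2 := by
    rw [h0]
    apply integral_congr_ae
    filter_upwards [key] with x hx
    rw [hx]
  rw [← h1, ← h2, Lp.norm_fourier_eq]


noncomputable def cv (U V : ℝ → ℝ) (t : ℝ) : ℝ := ∫ s, U s * V (t - s)

lemma cv_comm (U V : ℝ → ℝ) (t : ℝ) : cv U V t = cv V U t := by
  unfold cv
  rw [← integral_sub_left_eq_self _ volume t]
  simp [mul_comm]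

lemma cv_eq (U V : ℝ → ℝ) : cv U V = convolution U V (ContinuousLinearMap.mul ℝ ℝ) volume := by
  ext t; simp [cv, convolution_def]

lemma cv_integrable {U V : ℝ → ℝ} (hU : Integrable U) (hV : Integrable V) :
    Integrable (cv U V) := by
  rw [cv_eq]; exact hU.integrable_convolution _ hV

lemma integral_cv {U V : ℝ → ℝ} (hU : Integrable U) (hV : Integrable V) :
    ∫ t, cv U V t = (∫ t, U t) * ∫ t, V t := by
  rw [cv_eq, integral_convolution _ hU hV]; simp

noncomputable def ft (f : ℝ → ℝ) (u : ℝ) : ℂ :=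
  ∫ t : ℝ, Complex.exp (-(Complex.I * u * t)) * (f t : ℂ)

lemma norm_exp_aux (u t : ℝ) : ‖Complex.exp (-(Complex.I * u * t))‖ = 1 := by
  rw [Complex.norm_exp]; simp

lemma ft_integrand_integrable {f : ℝ → ℝ} (hf : Integrable f) (u : ℝ) :
    Integrable (fun t : ℝ => Complex.exp (-(Complex.I * u * t)) * (f t : ℂ)) := by
  refine hf.ofReal.bdd_mul (c := 1) (by fun_prop) ?_
  exact Eventually.of_forall fun t => (norm_exp_aux u t).le

lemma ft_cv {U V : ℝ → ℝ} (hU : Integrable U) (hV : Integrable V) (u : ℝ) :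
    ft (cv U V) u = ft U u * ft V u := by
  have := integral_convolution (ContinuousLinearMap.mul ℝ ℂ) (ft_integrand_integrable hU u)
    (ft_integrand_integrable hV u) (ν := volume) (μ := volume)
  simp only [ContinuousLinearMap.mul_apply'] at this
  unfold ft
  rw [← this]
  congr 1 with t
  simp only [convolution_def, cv, ContinuousLinearMap.mul_apply']
  rw [← integral_complex_ofReal, ← integral_const_mul]
  congr 1 with s
  push_cast
  have : Complex.exp (-(Complex.I * u * t)) = Complex.exp (-(Complex.I * u * s)) *
      Complex.exp (-(Complex.I * u * (t - s))) := by
    rw [← Complex.exp_add]; congr 1; ring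
  rw [this]; ring

lemma integral_Iic_cv {U V : ℝ → ℝ} (hU : Integrable U) (hV : Integrable V) (T : ℝ) :
    ∫ t in Iic T, cv U V t = ∫ s, U s * ∫ t in Iic (T - s), V t := by
  have h := hU.convolution_integrand (ContinuousLinearMap.mul ℝ ℝ) hV (μ := volume) (ν := volume)
  simp only [ContinuousLinearMap.mul_apply'] at h
  have h' : Integrable (Function.uncurry fun t s => U s * V (t - s)) ((volume.restrict (Iic T)).prod volume) := by
    refine Integrable.mono_measure h ?_
    exact Measure.prod_mono Measure.restrict_le_self le_rfl
  unfold cv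
  rw [integral_integral_swap h']
  congr 1 with s
  rw [integral_const_mul]
  congr 1
  rw [← integral_indicator measurableSet_Iic, ← integral_indicator measurableSet_Iic,
    ← integral_sub_right_eq_self ((Iic (T - s)).indicator fun t => V t) s]
  congr 1 with t
  simp [indicator]

noncomputable def rk (U : ℝ → ℝ) : ℕ → ℝ → ℝ
  | 0 => U
  | (k + 1) => cv U (rk U k)

structure GoodU (U : ℝ → ℝ) (a : ℝ) : Prop where
  int : Integrable U
  nn : ∀ t, 0 ≤ U t
  zero : ∀ t, t ≤ 0 → U t = 0
  bd : ∀ t, U t ≤ a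
  lt : ∫ t, U t < 1

namespace GoodU

lemma anonneg {U : ℝ → ℝ} {a : ℝ} (h : GoodU U a) : 0 ≤ a := (h.nn 0).trans (h.bd 0)

lemma rk_int {U : ℝ → ℝ} {a : ℝ} (h : GoodU U a) (k : ℕ) : Integrable (rk U k) := by
  induction k with
  | zero => exact h.int
  | succ k ih => exact cv_integrable h.int ih

lemma rk_nn {U : ℝ → ℝ} {a : ℝ} (h : GoodU U a) (k : ℕ) (t : ℝ) : 0 ≤ rk U k t := by
  induction k generalizing t with
  | zero => exact h.nn t
  | succ k ih => exact integral_nonneg fun s => mul_nonneg (h.nn s) (ih _)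

lemma rk_zero {U : ℝ → ℝ} {a : ℝ} (h : GoodU U a) (k : ℕ) (t : ℝ) (ht : t ≤ 0) : rk U k t = 0 := by
  induction k generalizing t with
  | zero => exact h.zero t ht
  | succ k ih =>
    show ∫ s, U s * rk U k (t - s) = 0
    convert integral_zero ℝ ℝ with s
    rcases le_total s 0 with hs | hs
    · rw [h.zero s hs, zero_mul]
    · rw [ih (t - s) (by linarith), mul_zero]

lemma integral_rk {U : ℝ → ℝ} {a : ℝ} (h : GoodU U a) (k : ℕ) :
    ∫ t, rk U k t = (∫ t, U t) ^ (k + 1) := by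
  induction k with
  | zero => simp [rk]
  | succ k ih =>
    show ∫ t, cv U (rk U k) t = _
    rw [integral_cv h.int (h.rk_int k), ih]; ring

lemma ft_rk {U : ℝ → ℝ} {a : ℝ} (h : GoodU U a) (k : ℕ) (u : ℝ) :
    ft (rk U k) u = (ft U u) ^ (k + 1) := by
  induction k with
  | zero => simp [rk]
  | succ k ih =>
    show ft (cv U (rk U k)) u = _
    rw [ft_cv h.int (h.rk_int k), ih]; ring

lemma rho_nn {U : ℝ → ℝ} {a : ℝ} (h : GoodU U a) : 0 ≤ ∫ t, U t := integral_nonneg h.nn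

lemma rk_bd {U : ℝ → ℝ} {a : ℝ} (h : GoodU U a) (k : ℕ) (t : ℝ) :
    rk U k t ≤ a * (∫ t, U t) ^ k := by
  cases k with
  | zero => simpa [rk] using h.bd t
  | succ k =>
    show cv U (rk U k) t ≤ _
    rw [cv_comm, ← h.integral_rk k, ← integral_const_mul]
    refine integral_mono_of_nonneg (Eventually.of_forall fun s => mul_nonneg (h.rk_nn k s) (h.nn _))
      ((h.rk_int k).const_mul a) (Eventually.of_forall fun s => ?_)
    show rk U k s * U (t - s) ≤ a * rk U k s
    rw [mul_comm]
    exact mul_le_mul_of_nonneg_right (h.bd _) (h.rk_nn k s)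

lemma summable_rk {U : ℝ → ℝ} {a : ℝ} (h : GoodU U a) (t : ℝ) :
    Summable fun k => rk U k t :=
  Summable.of_nonneg_of_le (fun k => h.rk_nn k t) (fun k => h.rk_bd k t)
    ((summable_geometric_of_lt_one h.rho_nn h.lt).mul_left a)

end GoodU

noncomputable def rs (U : ℝ → ℝ) (t : ℝ) : ℝ := ∑' k, rk U k t

namespace GoodU

lemma rs_nn {U : ℝ → ℝ} {a : ℝ} (h : GoodU U a) (t : ℝ) : 0 ≤ rs U t :=
  tsum_nonneg fun k => h.rk_nn k t

lemma rs_zero {U : ℝ → ℝ} {a : ℝ} (h : GoodU U a) (t : ℝ) (ht : t ≤ 0) : rs U t = 0 := by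
  simp [rs, h.rk_zero _ t ht]

lemma summable_int {U : ℝ → ℝ} {a : ℝ} (h : GoodU U a) :
    Summable fun k => ∫ t, ‖rk U k t‖ := by
  have : (fun k => ∫ t, ‖rk U k t‖) = fun k => (∫ t, U t) * (∫ t, U t) ^ k := by
    ext k
    simp only [Real.norm_of_nonneg (h.rk_nn k _)]
    rw [h.integral_rk, pow_succ']
  rw [this]
  exact (summable_geometric_of_lt_one h.rho_nn h.lt).mul_left _

lemma rs_int {U : ℝ → ℝ} {a : ℝ} (h : GoodU U a) : Integrable (rs U) := by
  have hm : AEStronglyMeasurable (rs U) := by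
    refine aestronglyMeasurable_of_tendsto_ae atTop
      (f := fun N t => ∑ k ∈ Finset.range N, rk U k t) (fun N => ?_) ?_
    · exact (integrable_finsetSum _ fun k _ => h.rk_int k).aestronglyMeasurable
    · exact Eventually.of_forall fun t => (h.summable_rk t).hasSum.tendsto_sum_nat
  refine ⟨hm, ?_⟩
  rw [hasFiniteIntegral_iff_ofReal (Eventually.of_forall h.rs_nn)]
  have : ∀ t, ENNReal.ofReal (rs U t) = ∑' k, ENNReal.ofReal (rk U k t) := fun t =>
    ENNReal.ofReal_tsum_of_nonneg (fun k => h.rk_nn k t) (h.summable_rk t)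
  simp_rw [this]
  rw [lintegral_tsum (fun k => (h.rk_int k).aemeasurable.ennreal_ofReal)]
  have h2 : ∀ k, ∫⁻ t, ENNReal.ofReal (rk U k t) = ENNReal.ofReal ((∫ t, U t) ^ (k + 1)) := by
    intro k
    rw [← ofReal_integral_eq_lintegral_ofReal (h.rk_int k) (Eventually.of_forall (h.rk_nn k)),
      h.integral_rk]
  simp_rw [h2]
  rw [← ENNReal.ofReal_tsum_of_nonneg]
  · exact ENNReal.ofReal_lt_top
  · intro k; exact pow_nonneg h.rho_nn _
  · simp_rw [pow_succ']
    exact (summable_geometric_of_lt_one h.rho_nn h.lt).mul_left _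

lemma norm_ft_le {U : ℝ → ℝ} {a : ℝ} (h : GoodU U a) (u : ℝ) : ‖ft U u‖ ≤ ∫ t, U t := by
  unfold ft
  refine (norm_integral_le_integral_norm _).trans (le_of_eq ?_)
  congr 1 with t
  rw [norm_mul, norm_exp_aux, one_mul, Complex.norm_real, Real.norm_of_nonneg (h.nn t)]

lemma ft_rs {U : ℝ → ℝ} {a : ℝ} (h : GoodU U a) (u : ℝ) :
    1 + ft (rs U) u = (1 - ft U u)⁻¹ := by
  have h1 := hasSum_integral_of_summable_integral_norm
    (F := fun k (t : ℝ) => Complex.exp (-(Complex.I * u * t)) * (rk U k t : ℂ))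
    (fun k => ft_integrand_integrable (h.rk_int k) u) (by
      simpa only [norm_mul, norm_exp_aux, one_mul, Complex.norm_real] using h.summable_int)
  have h2 : ∀ t : ℝ, ∑' k, Complex.exp (-(Complex.I * u * t)) * (rk U k t : ℂ)
      = Complex.exp (-(Complex.I * u * t)) * (rs U t : ℂ) := by
    intro t
    rw [tsum_mul_left, rs, Complex.ofReal_tsum]
  simp only [h2] at h1
  have h3 : HasSum (fun k => (ft U u) ^ (k + 1)) (ft (rs U) u) := by
    have : (fun k => (ft U u) ^ (k + 1)) = fun k => ft (rk U k) u := by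
      ext k; rw [h.ft_rk]
    rw [this]; exact h1
  have h4 := hasSum_geometric_of_norm_lt_one ((h.norm_ft_le u).trans_lt h.lt)
  have h5 := (hasSum_nat_add_iff' 1).mpr h4
  have := h3.unique h5
  rw [this]; simp

lemma window_rk {U : ℝ → ℝ} {a : ℝ} (h : GoodU U a) {L : ℝ} (hL : 0 ≤ L) (haL : a * L ≤ 1 / 2)
    (T : ℝ) (k : ℕ) :
    (1 / 2) * ∫ t in Ioc (T - L) T, rk U k t ≤
      (∫ t in Iic T, rk U k t) - ∫ t in Iic T, rk U (k + 1) t := by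
  have e1 : ∫ t in Iic T, rk U (k + 1) t = ∫ s, rk U k s * ∫ t in Iic (T - s), U t := by
    rw [← integral_Iic_cv (h.rk_int k) h.int]
    congr 1 with t
    exact cv_comm _ _ _
  rw [e1, ← integral_indicator measurableSet_Iic, ← integral_indicator measurableSet_Ioc,
    ← integral_const_mul, le_sub_comm, ← integral_sub]
  rotate_left
  · exact (h.rk_int k).indicator measurableSet_Iic
  · exact ((h.rk_int k).indicator measurableSet_Ioc).const_mul _
  refine integral_mono_of_nonneg (Eventually.of_forall fun s => ?_) ?_ (Eventually.of_forall fun s => ?_)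
  · exact mul_nonneg (h.rk_nn k s) (integral_nonneg h.nn)
  · exact ((h.rk_int k).indicator measurableSet_Iic).sub
      (((h.rk_int k).indicator measurableSet_Ioc).const_mul _)
  show rk U k s * ∫ t in Iic (T - s), U t ≤ (Iic T).indicator (rk U k) s
    - 1 / 2 * (Ioc (T - L) T).indicator (rk U k) s
  have hle1 : ∫ t in Iic (T - s), U t ≤ 1 :=
    (setIntegral_le_integral h.int (Eventually.of_forall h.nn)).trans h.lt.le
  have hr := h.rk_nn k s
  rcases lt_or_ge T s with hs | hs
  · have : ∫ t in Iic (T - s), U t = 0 := by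
      rw [setIntegral_eq_zero_of_forall_eq_zero]
      intro t ht
      exact h.zero t (by have := mem_Iic.mp ht; linarith)
    rw [this, indicator_of_notMem (by simpa using hs), indicator_of_notMem (by simp [hs])]
    simp
  · rw [indicator_of_mem (by simpa using hs)]
    by_cases h1 : T - L < s
    · rw [indicator_of_mem (by exact ⟨h1, hs⟩)]
      have : ∫ t in Iic (T - s), U t ≤ 1 / 2 := by
        have e : ∫ t in Iic (T - s), U t = ∫ t in Ioc 0 (T - s), U t := by
          rw [← integral_indicator measurableSet_Iic, ← integral_indicator measurableSet_Ioc]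
          congr 1 with t
          by_cases ht : 0 < t
          · simp [indicator, ht]
          · simp [indicator, ht, h.zero t (not_lt.mp ht)]
        rw [e]
        calc ∫ t in Ioc 0 (T - s), U t ≤ ∫ t in Ioc 0 (T - s), a :=
              setIntegral_mono_on h.int.integrableOn (by simp) measurableSet_Ioc
                (fun t _ => h.bd t)
          _ = a * (T - s) := by
              simp [hs, mul_comm]
          _ ≤ a * L := mul_le_mul_of_nonneg_left (by linarith) h.anonneg
          _ ≤ 1 / 2 := haL
      nlinarith
    · rw [indicator_of_notMem (by simp [h1])]
      nlinarith

lemma window_rs {U : ℝ → ℝ} {a : ℝ} (h : GoodU U a) {L : ℝ} (hL : 0 ≤ L) (haL : a * L ≤ 1 / 2)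
    (T : ℝ) : ∫ t in Ioc (T - L) T, rs U t ≤ 2 := by
  have h1 := hasSum_integral_of_summable_integral_norm (μ := volume.restrict (Ioc (T - L) T))
    (F := fun k => rk U k) (fun k => (h.rk_int k).integrableOn) (by
      refine Summable.of_nonneg_of_le (fun k => integral_nonneg fun t => norm_nonneg _)
        (fun k => ?_) h.summable_int
      exact setIntegral_le_integral (h.rk_int k).norm (Eventually.of_forall fun t => norm_nonneg _))
  refine le_of_tendsto h1.tendsto_sum_nat (Eventually.of_forall fun N => ?_)
  have h2 : ∀ N, (1 / 2) * ∑ k ∈ Finset.range N, ∫ t in Ioc (T - L) T, rk U k t ≤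
      (∫ t in Iic T, rk U 0 t) - ∫ t in Iic T, rk U N t := by
    intro N
    induction N with
    | zero => simp
    | succ N ih =>
      rw [Finset.sum_range_succ, mul_add]
      have := h.window_rk hL haL T N
      linarith
  have h3 : ∫ t in Iic T, rk U 0 t ≤ 1 :=
    (setIntegral_le_integral h.int (Eventually.of_forall h.nn)).trans h.lt.le
  have h4 : 0 ≤ ∫ t in Iic T, rk U N t := integral_nonneg (h.rk_nn N)
  have := h2 N
  linarith

end GoodU


lemma cv_interval {U V : ℝ → ℝ} (hU : ∀ t ≤ 0, U t = 0) (hV : ∀ t ≤ 0, V t = 0) {t : ℝ}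
    (ht : 0 < t) {F : ℝ → ℝ} (hF : ∀ s ∈ Ioo 0 t, F s = U s * V (t - s)) :
    ∫ s in (0:ℝ)..t, F s = cv U V t := by
  rw [intervalIntegral.integral_of_le ht.le, integral_Ioc_eq_integral_Ioo,
    setIntegral_congr_fun measurableSet_Ioo hF, ← integral_indicator measurableSet_Ioo]
  unfold cv
  congr 1 with s
  by_cases h1 : 0 < s
  · by_cases h2 : s < t
    · rw [indicator_of_mem (by exact ⟨h1, h2⟩)]
    · rw [indicator_of_notMem (by simp [h2]), hV (t - s) (by linarith), mul_zero]
  · rw [indicator_of_notMem (by simp [h1]), hU s (by linarith), zero_mul]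

lemma convIter_eq {U f : ℝ → ℝ} {a b : ℝ} (h : GoodU U b) (hUf : ∀ t, 0 < t → U t = a * f t)
    (k : ℕ) (t : ℝ) (ht : 0 < t) : a ^ (k + 1) * convIter f k t = rk U k t := by
  induction k generalizing t with
  | zero => simp [convIter, rk, hUf t ht]
  | succ k ih =>
    simp only [convIter]
    rw [← intervalIntegral.integral_const_mul]
    refine cv_interval h.zero (h.rk_zero k) ht ?_
    intro s hs
    rw [← ih (t - s) (by linarith [hs.2]), hUf s hs.1]
    ring

lemma resolvent_eq {U f : ℝ → ℝ} {a b : ℝ} (h : GoodU U b) (hUf : ∀ t, 0 < t → U t = a * f t)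
    (t : ℝ) (ht : 0 < t) : resolventFn a f t = rs U t := by
  unfold resolventFn rs
  congr 1 with k
  exact convIter_eq h hUf k t ht

noncomputable def hh (lamn γn β : ℝ) {k : ℕ} (y : Fin k → ℝ) : ℝ → ℝ :=
  (Ioi 0).indicator fun s =>
    lamn * (Real.exp (-(β * s) / γn) * (∑ j, if s < y j then (1:ℝ) else 0))

noncomputable def Kf (h U : ℝ → ℝ) (t : ℝ) : ℝ := h t + cv h (rs U) t

lemma resolventK_eq {U R : ℝ → ℝ} {b lamn γn β : ℝ} {k : ℕ} {y : Fin k → ℝ} (h : GoodU U b)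
    (hR : ∀ t, 0 < t → R t = rs U t) (t : ℝ) (ht : 0 < t) :
    resolventK lamn γn β R y t = Kf (hh lamn γn β y) U t := by
  unfold resolventK Kf
  congr 1
  · rw [hh, indicator_of_mem (by exact ht)]; ring
  · rw [← intervalIntegral.integral_const_mul]
    refine cv_interval (fun s hs => ?_) h.rs_zero ht ?_
    · rw [hh, indicator_of_notMem (by simp [hs])]
    · intro s hs
      rw [hh, indicator_of_mem (by exact hs.1), hR (t - s) (by linarith [hs.2])]
      ring

lemma GoodU.window_mul {U : ℝ → ℝ} {a : ℝ} (h : GoodU U a) {L : ℝ} (hL : 0 ≤ L)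
    (haL : a * L ≤ 1 / 2) (N : ℕ) (T : ℝ) : ∫ t in Ioc (T - N * L) T, rs U t ≤ 2 * N := by
  induction N generalizing T with
  | zero => simp
  | succ N ih =>
    have : Ioc (T - (N + 1 : ℕ) * L) T = Ioc ((T - L) - N * L) (T - L) ∪ Ioc (T - L) T := by
      rw [Ioc_union_Ioc_eq_Ioc (by nlinarith [(Nat.cast_nonneg N : (0:ℝ) ≤ N)]) (by linarith)]
      congr 1; push_cast; ring
    rw [this, setIntegral_union (Ioc_disjoint_Ioc_of_le le_rfl) measurableSet_Ioc
      h.rs_int.integrableOn h.rs_int.integrableOn]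
    have h1 := ih (T - L)
    have h2 := h.window_rs hL haL T
    push_cast
    linarith

lemma Kf_nn {h U : ℝ → ℝ} {a : ℝ} (hU : GoodU U a) (hn : ∀ t, 0 ≤ h t) (t : ℝ) : 0 ≤ Kf h U t :=
  add_nonneg (hn t) (integral_nonneg fun s => mul_nonneg (hn s) (hU.rs_nn _))

lemma Kf_int {h U : ℝ → ℝ} {a : ℝ} (hU : GoodU U a) (hi : Integrable h) : Integrable (Kf h U) :=
  hi.add (cv_integrable hi hU.rs_int)

lemma ft_add {f g : ℝ → ℝ} (hf : Integrable f) (hg : Integrable g) (u : ℝ) :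
    ft (fun t => f t + g t) u = ft f u + ft g u := by
  unfold ft
  rw [← integral_add (ft_integrand_integrable hf u) (ft_integrand_integrable hg u)]
  congr 1 with t; push_cast; ring

lemma ft_sub {f g : ℝ → ℝ} (hf : Integrable f) (hg : Integrable g) (u : ℝ) :
    ft (fun t => f t - g t) u = ft f u - ft g u := by
  unfold ft
  rw [← integral_sub (ft_integrand_integrable hf u) (ft_integrand_integrable hg u)]
  congr 1 with t; push_cast; ring

lemma ft_Kf {h U : ℝ → ℝ} {a : ℝ} (hU : GoodU U a) (hi : Integrable h) (u : ℝ) :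
    ft (Kf h U) u = ft h u * (1 - ft U u)⁻¹ := by
  have : ft (Kf h U) u = ft h u + ft (cv h (rs U)) u := ft_add hi (cv_integrable hi hU.rs_int) u
  rw [this, ft_cv hi hU.rs_int, ← hU.ft_rs]; ring

lemma Kf_le {h U : ℝ → ℝ} {a M Y L : ℝ} (hU : GoodU U a) (hn : ∀ t, 0 ≤ h t)
    (hM : ∀ t, h t ≤ M) (h0 : ∀ t ≤ 0, h t = 0) (hY : ∀ t, Y ≤ t → h t = 0)
    (hL : 0 ≤ L) (haL : a * L ≤ 1 / 2) (N : ℕ) (hN : Y ≤ N * L) (t : ℝ) :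
    Kf h U t ≤ M + M * (2 * N) := by
  have hM0 : 0 ≤ M := (hn 0).trans (hM 0)
  refine add_le_add (hM t) ?_
  rw [cv_comm]
  calc cv (rs U) h t ≤ ∫ s, (Ioc (t - N * L) t).indicator (fun s => M * rs U s) s := by
        refine integral_mono_of_nonneg
          (Eventually.of_forall fun s => mul_nonneg (hU.rs_nn s) (hn _))
          ((hU.rs_int.const_mul M).indicator measurableSet_Ioc) (Eventually.of_forall fun s => ?_)
        show rs U s * h (t - s) ≤ (Ioc (t - N * L) t).indicator (fun s => M * rs U s) s
        by_cases h1 : s ∈ Ioc (t - N * L) t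
        · rw [indicator_of_mem h1, mul_comm]
          exact mul_le_mul_of_nonneg_right (hM _) (hU.rs_nn s)
        · rw [indicator_of_notMem h1]
          have : h (t - s) = 0 := by
            simp only [mem_Ioc, not_and_or, not_lt, not_le] at h1
            rcases h1 with h1 | h1
            · exact hY _ (by linarith)
            · exact h0 _ (by linarith)
          rw [this, mul_zero]
    _ = M * ∫ s in Ioc (t - N * L) t, rs U s := by
        rw [integral_indicator measurableSet_Ioc, integral_const_mul]
    _ ≤ M * (2 * N) := mul_le_mul_of_nonneg_left (hU.window_mul hL haL N t) hM0

lemma ft_scale (f : ℝ → ℝ) {γ : ℝ} (hγ : 0 < γ) (u : ℝ) :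
    ft (fun t => f (γ * t)) u = (γ : ℂ)⁻¹ * ft f (u / γ) := by
  unfold ft
  have := Measure.integral_comp_mul_left
    (fun t : ℝ => Complex.exp (-(Complex.I * (u / γ : ℝ) * t)) * (f t : ℂ)) γ
  rw [abs_of_pos (inv_pos.mpr hγ)] at this
  rw [← Complex.ofReal_inv, ← Complex.real_smul, ← this]
  congr 1 with t
  have hγ' : (γ : ℂ) ≠ 0 := by exact_mod_cast hγ.ne'
  congr 3
  push_cast
  field_simp

noncomputable def kk (A c : ℝ) : ℝ → ℝ := (Ioi 0).indicator fun t => A * Real.exp (-c * t)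

lemma kk_int (A : ℝ) {c : ℝ} (hc : 0 < c) : Integrable (kk A c) := by
  unfold kk
  rw [integrable_indicator_iff measurableSet_Ioi]
  exact (exp_neg_integrableOn_Ioi 0 hc).const_mul A

lemma kk_bd (A : ℝ) {c : ℝ} (hc : 0 < c) (t : ℝ) : |kk A c t| ≤ |A| := by
  unfold kk
  by_cases ht : 0 < t
  · rw [indicator_of_mem (by exact ht), abs_mul, abs_of_pos (Real.exp_pos _)]
    refine mul_le_of_le_one_right (abs_nonneg _) (Real.exp_le_one_iff.mpr ?_)
    nlinarith
  · rw [indicator_of_notMem (by simpa using ht)]; simp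

lemma ft_kk (A : ℝ) {c : ℝ} (hc : 0 < c) (u : ℝ) :
    ft (kk A c) u = A / (c + Complex.I * u) := by
  unfold ft
  have h1 : ∀ t : ℝ, Complex.exp (-(Complex.I * u * t)) * (kk A c t : ℂ)
      = (Ioi (0:ℝ)).indicator (fun t : ℝ => A * Complex.exp (-(c + Complex.I * u) * t)) t := by
    intro t
    unfold kk
    by_cases ht : 0 < t
    · rw [indicator_of_mem (by exact ht), indicator_of_mem (by exact ht)]
      push_cast
      rw [mul_left_comm, ← Complex.exp_add]
      congr 2; ring
    · rw [indicator_of_notMem (by simpa using ht), indicator_of_notMem (by simpa using ht)]; simp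
  simp_rw [h1]
  rw [integral_indicator measurableSet_Ioi, integral_const_mul,
    integral_exp_mul_complex_Ioi (by simp [hc])]
  rw [div_eq_mul_inv, div_eq_mul_inv, inv_neg]
  simp

lemma main_bound {h U : ℝ → ℝ} {a B A c γ κ : ℝ} (hU : GoodU U a) (hi : Integrable h)
    (hn : ∀ t, 0 ≤ h t) (h0 : ∀ t ≤ 0, h t = 0)
    (hB : ∀ t, Kf h U t ≤ B) (hγ : 0 < γ) (hc : 0 < c) (hκ : 1 ≤ κ) :
    ∫ t in Ioi (0:ℝ), |Kf h U (γ * t) - A * Real.exp (-c * t)| ^ (2 * κ) ≤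
      (B + |A|) ^ (2 * κ - 2) * ∫ w : ℝ, ‖(γ : ℂ)⁻¹ * (ft h (2 * Real.pi * w / γ) *
        (1 - ft U (2 * Real.pi * w / γ))⁻¹) - A / (c + Complex.I * (2 * Real.pi * w : ℝ))‖ ^ 2 := by
  set E : ℝ → ℝ := fun t => Kf h U (γ * t) - kk A c t with hE
  have hK := Kf_int hU hi
  have hKγ : Integrable (fun t => Kf h U (γ * t)) := hK.comp_mul_left' hγ.ne'
  have hEi : Integrable E := hKγ.sub (kk_int A hc)
  have hEb : ∀ t, |E t| ≤ B + |A| := by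
    intro t
    refine (abs_sub _ _).trans (add_le_add ?_ (kk_bd A hc t))
    rw [abs_of_nonneg (Kf_nn hU hn _)]; exact hB _
  have hE2 : MemLp (fun t => (E t : ℂ)) 2 := by
    have : Integrable (fun t => (E t : ℂ)) := hEi.ofReal
    rw [memLp_two_iff_integrable_sq_norm this.1]
    have h2 := this.norm.bdd_mul (c := B + |A|) this.norm.1
      (Eventually.of_forall fun t => by simpa using hEb t)
    refine h2.congr (Eventually.of_forall fun t => ?_)
    simp only [sq]
  have hP := aux_plancherel (fun t => (E t : ℂ)) hEi.ofReal hE2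
  have hF : ∀ w : ℝ, FourierTransform.fourier (fun t => (E t : ℂ)) w = (γ : ℂ)⁻¹ *
      (ft h (2 * Real.pi * w / γ) *
        (1 - ft U (2 * Real.pi * w / γ))⁻¹) - A / (c + Complex.I * (2 * Real.pi * w : ℝ)) := by
    intro w
    rw [← ft_Kf hU hi, ← ft_scale _ hγ, ← ft_kk A hc, ← ft_sub hKγ (kk_int A hc),
      Real.fourier_real_eq_integral_exp_smul]
    unfold ft
    congr 1 with t
    rw [smul_eq_mul]
    congr 2
    push_cast; ring
  simp_rw [hF] at hP
  rw [← hP]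
  have hBA : 0 ≤ B + |A| := (abs_nonneg _).trans (hEb 0)
  have hsq : Integrable (fun t => ‖(E t : ℂ)‖ ^ 2) := by
    exact (memLp_two_iff_integrable_sq_norm hE2.1).mp hE2
  rw [← integral_indicator measurableSet_Ioi, ← integral_const_mul]
  refine integral_mono_of_nonneg (Eventually.of_forall fun t => ?_) (hsq.const_mul _)
    (Eventually.of_forall fun t => ?_)
  · exact indicator_nonneg (fun t _ => Real.rpow_nonneg (abs_nonneg _) _) t
  · have hnn : 0 ≤ (B + |A|) ^ (2 * κ - 2) * ‖(E t : ℂ)‖ ^ 2 := by positivity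
    by_cases ht : 0 < t
    · rw [indicator_of_mem (by exact ht)]
      have e : Kf h U (γ * t) - A * Real.exp (-c * t) = E t := by
        simp only [hE, kk]; rw [indicator_of_mem (by exact ht)]
      rw [e]
      simp only [Complex.norm_real, Real.norm_eq_abs]
      have e2 : |E t| ^ (2 * κ) = |E t| ^ (2 * κ - 2) * |E t| ^ 2 := by
        rw [← Real.rpow_natCast, ← Real.rpow_add_of_nonneg (abs_nonneg _) (by linarith) (by norm_num)]
        congr 1; push_cast; ring
      rw [e2]
      refine mul_le_mul_of_nonneg_right ?_ (by positivity)
      exact Real.rpow_le_rpow (abs_nonneg _) (hEb t) (by linarith)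
    · rw [indicator_of_notMem (by simpa using ht)]; exact hnn

lemma layer_gen (μ : Measure ℝ) [IsProbabilityMeasure μ] (hs : μ (Iio 0) = 0) {g G : ℝ → ℝ}
    (hg : Continuous g) (hg0 : ∀ t, 0 ≤ t → 0 ≤ g t) (hG : ∀ x, 0 ≤ x → ∫ t in (0:ℝ)..x, g t = G x)
    (hGi : Integrable G μ) :
    IntegrableOn (fun t => g t * (μ (Ioi t)).toReal) (Ioi 0) ∧
      ∫ t in Ioi (0:ℝ), g t * (μ (Ioi t)).toReal = ∫ t, G t ∂μ := by
  have hae : ∀ᵐ x ∂μ, 0 ≤ x := by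
    rw [ae_iff]; convert hs using 2; ext x; simp
  have key := lintegral_comp_eq_lintegral_meas_lt_mul μ (f := fun x => x) (g := g)
    hae aemeasurable_id (fun t _ => hg.intervalIntegrable _ _)
    ((ae_restrict_iff' measurableSet_Ioi).mpr (Eventually.of_forall fun t ht => hg0 t (le_of_lt ht)))
  have hG0 : ∀ᵐ x ∂μ, 0 ≤ G x := by
    filter_upwards [hae] with x hx
    rw [← hG x hx]
    exact intervalIntegral.integral_nonneg hx fun t ht => hg0 t ht.1
  have e1 : ∫⁻ x, ENNReal.ofReal (∫ t in (0:ℝ)..x, g t) ∂μ = ∫⁻ x, ENNReal.ofReal (G x) ∂μ := by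
    refine lintegral_congr_ae ?_
    filter_upwards [hae] with x hx
    rw [hG x hx]
  have e2 : ∫⁻ t in Ioi (0:ℝ), μ {a | t < a} * ENNReal.ofReal (g t)
      = ∫⁻ t in Ioi (0:ℝ), ENNReal.ofReal (g t * (μ (Ioi t)).toReal) := by
    refine setLIntegral_congr_fun measurableSet_Ioi fun t ht => ?_
    show μ (Ioi t) * _ = _
    rw [ENNReal.ofReal_mul (hg0 t (le_of_lt ht)), ENNReal.ofReal_toReal (measure_ne_top _ _), mul_comm]
  rw [e1, e2] at key
  have hanti : Antitone fun t : ℝ => (μ (Ioi t)).toReal := fun s t hst =>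
    ENNReal.toReal_mono (measure_ne_top _ _) (measure_mono (Ioi_subset_Ioi hst))
  have hm : AEStronglyMeasurable (fun t => g t * (μ (Ioi t)).toReal) (volume.restrict (Ioi 0)) :=
    (hg.measurable.mul hanti.measurable).aestronglyMeasurable
  have hnn : 0 ≤ᵐ[volume.restrict (Ioi 0)] (fun t => g t * (μ (Ioi t)).toReal) :=
    (ae_restrict_iff' measurableSet_Ioi).mpr
      (Eventually.of_forall fun t ht => mul_nonneg (hg0 t (le_of_lt ht)) ENNReal.toReal_nonneg)
  have hfin : ∫⁻ x, ENNReal.ofReal (G x) ∂μ < ⊤ := by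
    rw [← hasFiniteIntegral_iff_ofReal hG0]; exact hGi.2
  refine ⟨⟨hm, ?_⟩, ?_⟩
  · rw [hasFiniteIntegral_iff_ofReal hnn, ← key]; exact hfin
  · rw [integral_eq_lintegral_of_nonneg_ae hnn hm, ← key, integral_eq_lintegral_of_nonneg_ae hG0 hGi.1]

lemma layer1 (μ : Measure ℝ) [IsProbabilityMeasure μ] (hs : μ (Iio 0) = 0)
    (h1 : Integrable (fun t => t) μ) :
    IntegrableOn (fun t => (μ (Ioi t)).toReal) (Ioi 0) ∧
      ∫ t in Ioi (0:ℝ), (μ (Ioi t)).toReal = ∫ t, t ∂μ := by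
  have := layer_gen μ hs (g := fun _ => 1) (G := fun x => x) continuous_const (by simp)
    (by simp) h1
  simpa using this

lemma layer2 (μ : Measure ℝ) [IsProbabilityMeasure μ] (hs : μ (Iio 0) = 0)
    (h1 : Integrable (fun t => t ^ 2) μ) :
    IntegrableOn (fun t => t * (μ (Ioi t)).toReal) (Ioi 0) ∧
      ∫ t in Ioi (0:ℝ), t * (μ (Ioi t)).toReal = (1/2) * ∫ t, t ^ 2 ∂μ := by
  have := layer_gen μ hs (g := fun t => t) (G := fun x => (1/2) * x ^ 2) continuous_id (by simp)
    (by intro x _; rw [integral_id]; ring) (h1.const_mul _)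
  rw [integral_const_mul] at this
  exact this

lemma star_mom (μ : Measure ℝ) [IsProbabilityMeasure μ] (hs : μ (Iio 0) = 0) {α : ℝ} (hα : 1 < α)
    (h : Integrable (fun t => t ^ (2 * α)) μ) :
    IntegrableOn (fun t => (μ (Ioi t)).toReal) (Ioi 0) ∧
    IntegrableOn (fun t => t * (μ (Ioi t)).toReal) (Ioi 0) := by
  have hae : ∀ᵐ x ∂μ, 0 ≤ x := by
    rw [ae_iff]; convert hs using 2; ext x; simp
  have hi : Integrable (fun t : ℝ => 1 + t ^ (2 * α)) μ := (integrable_const 1).add h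
  constructor
  · refine (layer1 μ hs (hi.mono' measurable_id.aestronglyMeasurable ?_)).1
    filter_upwards [hae] with x hx
    rw [Real.norm_eq_abs, abs_of_nonneg hx]
    have h0 : 0 ≤ x ^ (2 * α) := Real.rpow_nonneg hx _
    rcases le_total x 1 with h1 | h1
    · linarith
    · have := Real.rpow_le_rpow_of_exponent_le h1 (show (1:ℝ) ≤ 2 * α by linarith)
      rw [Real.rpow_one] at this; linarith
  · refine (layer2 μ hs (hi.mono' (measurable_id.pow_const 2).aestronglyMeasurable ?_)).1
    filter_upwards [hae] with x hx
    rw [Real.norm_eq_abs, abs_of_nonneg (by positivity)]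
    have h0 : 0 ≤ x ^ (2 * α) := Real.rpow_nonneg hx _
    rcases le_total x 1 with h1 | h1
    · nlinarith
    · have := Real.rpow_le_rpow_of_exponent_le h1 (show (2:ℝ) ≤ 2 * α by linarith)
      rw [Real.rpow_two] at this; linarith

structure SU (β lam0 σ0 bm : ℝ) (a γ : ℕ → ℝ) (g : ℕ → ℝ → ℝ) (G : ℝ → ℝ) : Prop where
  hβ : 0 ≤ β
  hlam0 : 0 < lam0
  hσ0 : 0 < σ0
  hc : 0 < bm + β * σ0 * lam0
  a_pos : ∀ n, 0 < a n
  γ_pos : ∀ n, 0 < γ n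
  a_lim : Tendsto a atTop (nhds lam0)
  γ_top : Tendsto γ atTop atTop
  g_anti : ∀ n, Antitone (g n)
  g_nn : ∀ n t, 0 ≤ g n t
  g_le : ∀ n t, g n t ≤ 1
  g_dom : ∀ n t, 0 < t → g n t ≤ G t
  G_int : IntegrableOn G (Ioi 0)
  tG_int : IntegrableOn (fun t => t * G t) (Ioi 0)
  lim1 : Tendsto (fun n => γ n * (1 - a n * ∫ t in Ioi (0:ℝ), g n t)) atTop (nhds bm)
  lim2 : Tendsto (fun n => ∫ t in Ioi (0:ℝ), t * g n t) atTop (nhds σ0)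

noncomputable def UU (β a γ : ℝ) (g : ℝ → ℝ) : ℝ → ℝ :=
  (Ioi 0).indicator fun t => a * (Real.exp (-(β * t) / γ) * g t)

lemma one_sub_exp_le {w : ℂ} (hw : 0 ≤ w.re) : ‖1 - Complex.exp (-w)‖ ≤ 2 * ‖w‖ := by
  rcases le_total ‖w‖ 1 with h | h
  · have := Complex.norm_exp_sub_one_le (x := -w) (by simpa using h)
    rwa [norm_neg, norm_sub_rev] at this
  · have h1 : ‖Complex.exp (-w)‖ ≤ 1 := by
      rw [Complex.norm_exp]; simpa using hw
    calc _ ≤ ‖(1:ℂ)‖ + ‖Complex.exp (-w)‖ := norm_sub_le _ _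
      _ ≤ 2 * ‖w‖ := by rw [norm_one]; linarith

lemma one_sub_exp_sub_le {w : ℂ} (hw : ‖w‖ ≤ 1) : ‖1 - Complex.exp (-w) - w‖ ≤ ‖w‖ ^ 2 := by
  have := Complex.norm_exp_sub_one_sub_id_le (x := -w) (by simpa using hw)
  rw [norm_neg w] at this
  rw [← norm_neg]
  have e : -(1 - Complex.exp (-w) - w) = Complex.exp (-w) - 1 - -w := by ring
  rwa [e]

namespace SU

variable {β lam0 σ0 bm : ℝ} {a γ : ℕ → ℝ} {g : ℕ → ℝ → ℝ} {G : ℝ → ℝ}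

lemma g_int (S : SU β lam0 σ0 bm a γ g G) (n : ℕ) : IntegrableOn (g n) (Ioi 0) := by
  refine S.G_int.mono' (S.g_anti n).measurable.aestronglyMeasurable
    ((ae_restrict_iff' measurableSet_Ioi).mpr (Eventually.of_forall fun t ht => ?_))
  rw [Real.norm_eq_abs, abs_of_nonneg (S.g_nn n t)]
  exact S.g_dom n t ht

lemma tg_int (S : SU β lam0 σ0 bm a γ g G) (n : ℕ) : IntegrableOn (fun t => t * g n t) (Ioi 0) := by
  refine S.tG_int.mono' (measurable_id.mul (S.g_anti n).measurable).aestronglyMeasurable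
    ((ae_restrict_iff' measurableSet_Ioi).mpr (Eventually.of_forall fun t ht => ?_))
  have ht' : 0 < t := ht
  rw [Real.norm_eq_abs, abs_of_nonneg (mul_nonneg ht'.le (S.g_nn n t))]
  exact mul_le_mul_of_nonneg_left (S.g_dom n t ht) ht'.le

lemma exp_bd (S : SU β lam0 σ0 bm a γ g G) (n : ℕ) {z : ℂ} (hz : 0 ≤ z.re) {t : ℝ} (ht : 0 < t) :
    0 ≤ (z * t / γ n).re := by
  have h : z * t / γ n = z * ((t / γ n : ℝ) : ℂ) := by push_cast; ring
  rw [h, Complex.re_mul_ofReal]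
  exact mul_nonneg hz (div_pos ht (S.γ_pos n)).le

lemma eg_int (S : SU β lam0 σ0 bm a γ g G) (n : ℕ) {z : ℂ} (hz : 0 ≤ z.re) :
    IntegrableOn (fun t : ℝ => Complex.exp (-(z * t / γ n)) * (g n t : ℂ)) (Ioi 0) := by
  refine (S.g_int n).mono' ?_
    ((ae_restrict_iff' measurableSet_Ioi).mpr (Eventually.of_forall fun t ht => ?_))
  · exact ((Continuous.measurable (by fun_prop)).mul
      (Complex.measurable_ofReal.comp (S.g_anti n).measurable)).aestronglyMeasurable
  · rw [norm_mul, Complex.norm_real, Real.norm_eq_abs, abs_of_nonneg (S.g_nn n t), Complex.norm_exp]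
    refine mul_le_of_le_one_left (S.g_nn n t) ?_
    rw [Real.exp_le_one_iff, Complex.neg_re]
    linarith [S.exp_bd n hz ht]

lemma lim_z (S : SU β lam0 σ0 bm a γ g G) {z : ℂ} (hz : 0 ≤ z.re) :
    Tendsto (fun n => (γ n : ℂ) * (1 - a n * ∫ t in Ioi (0:ℝ),
      Complex.exp (-(z * t / γ n)) * (g n t : ℂ))) atTop (nhds (bm + lam0 * σ0 * z)) := by
  have hdct : Tendsto (fun n => ∫ t in Ioi (0:ℝ),
      ((γ n : ℂ) * (1 - Complex.exp (-(z * t / γ n))) - z * t) * (g n t : ℂ)) atTop (nhds 0) := by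
    have : (0:ℂ) = ∫ t in Ioi (0:ℝ), (0:ℂ) := by simp
    rw [this]
    refine tendsto_integral_of_dominated_convergence (fun t => 3 * ‖z‖ * (t * G t)) ?_
      (S.tG_int.const_mul _) ?_ ?_
    · intro n
      exact ((Continuous.measurable (by fun_prop)).mul
        (Complex.measurable_ofReal.comp (S.g_anti n).measurable)).aestronglyMeasurable
    · intro n
      refine (ae_restrict_iff' measurableSet_Ioi).mpr (Eventually.of_forall fun t ht => ?_)
      have ht' : 0 < t := ht
      have hγ := S.γ_pos n
      rw [norm_mul, Complex.norm_real, Real.norm_eq_abs, abs_of_nonneg (S.g_nn n t)]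
      have h1 : ‖(γ n : ℂ) * (1 - Complex.exp (-(z * t / γ n))) - z * t‖ ≤ 3 * ‖z‖ * t := by
        refine (norm_sub_le _ _).trans ?_
        have h2 := one_sub_exp_le (S.exp_bd n hz ht')
        rw [norm_mul, norm_mul]
        rw [norm_div, norm_mul] at h2
        simp only [Complex.norm_real, Real.norm_eq_abs, abs_of_pos hγ, abs_of_pos ht'] at h2 ⊢
        have h3 := mul_le_mul_of_nonneg_left h2 hγ.le
        have h4 : γ n * (2 * (‖z‖ * t / γ n)) = 2 * ‖z‖ * t := by field_simp
        linarith
      calc _ ≤ (3 * ‖z‖ * t) * G t :=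
            mul_le_mul h1 (S.g_dom n t ht') (S.g_nn n t) (by positivity)
        _ = _ := by ring
    · refine (ae_restrict_iff' measurableSet_Ioi).mpr (Eventually.of_forall fun t ht => ?_)
      have ht' : 0 < t := ht
      have hlim : Tendsto (fun n => (‖z‖ * t) ^ 2 * (γ n)⁻¹) atTop (nhds 0) := by
        simpa using (tendsto_inv_atTop_zero.comp S.γ_top).const_mul ((‖z‖ * t) ^ 2)
      refine squeeze_zero_norm' ?_ hlim
      filter_upwards [S.γ_top.eventually_ge_atTop (‖z‖ * t)] with n hn
      have hγ := S.γ_pos n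
      rw [norm_mul, Complex.norm_real, Real.norm_eq_abs, abs_of_nonneg (S.g_nn n t)]
      refine (mul_le_of_le_one_right (norm_nonneg _) (S.g_le n t)).trans ?_
      have hw : ‖z * t / γ n‖ = ‖z‖ * t / γ n := by
        rw [norm_div, norm_mul]
        simp only [Complex.norm_real, Real.norm_eq_abs, abs_of_pos hγ, abs_of_pos ht']
      have h2 := one_sub_exp_sub_le (w := z * t / γ n) (by rw [hw, div_le_one hγ]; exact hn)
      have hγ' : (γ n : ℂ) ≠ 0 := by exact_mod_cast hγ.ne'
      have e : (γ n : ℂ) * (1 - Complex.exp (-(z * t / γ n))) - z * t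
          = γ n * (1 - Complex.exp (-(z * t / γ n)) - z * t / γ n) := by field_simp
      rw [e, norm_mul, Complex.norm_real, Real.norm_eq_abs, abs_of_pos hγ]
      rw [hw] at h2
      calc _ ≤ γ n * (‖z‖ * t / γ n) ^ 2 := mul_le_mul_of_nonneg_left h2 hγ.le
        _ = _ := by field_simp
  have hc := Complex.continuous_ofReal
  have l1 := (hc.tendsto _).comp S.lim1
  have l2 := (hc.tendsto _).comp S.lim2
  have l3 := (hc.tendsto _).comp S.a_lim
  have := (l1.add ((l3.mul l2).mul_const z)).add (l3.mul hdct)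
  rw [mul_zero, add_zero] at this
  refine this.congr fun n => ?_
  simp only [Function.comp]
  have i1 : IntegrableOn (fun t => ((g n t : ℝ) : ℂ)) (Ioi 0) := (S.g_int n).ofReal
  have i2 : IntegrableOn (fun t => ((t * g n t : ℝ) : ℂ)) (Ioi 0) := (S.tg_int n).ofReal
  have i3 := S.eg_int n hz
  have e : ∫ t in Ioi (0:ℝ), ((γ n : ℂ) * (1 - Complex.exp (-(z * t / γ n))) - z * t) * (g n t : ℂ)
      = γ n * (∫ t in Ioi (0:ℝ), ((g n t : ℝ) : ℂ))
        - γ n * (∫ t in Ioi (0:ℝ), Complex.exp (-(z * t / γ n)) * (g n t : ℂ))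
        - z * ∫ t in Ioi (0:ℝ), ((t * g n t : ℝ) : ℂ) := by
    rw [← integral_const_mul, ← integral_const_mul, ← integral_const_mul,
      ← integral_sub (i1.const_mul _) (i3.const_mul _),
      ← integral_sub ?_ (i2.const_mul _)]
    rotate_left
    · exact (i1.const_mul _).sub (i3.const_mul _)
    congr 1 with t
    push_cast; ring
  rw [e, integral_complex_ofReal, integral_complex_ofReal]
  push_cast; ring

lemma U_ind (S : SU β lam0 σ0 bm a γ g G) (n : ℕ) (u : ℝ) (t : ℝ) :
    Complex.exp (-(Complex.I * u * t)) * (UU β (a n) (γ n) (g n) t : ℂ) =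
    (Ioi (0:ℝ)).indicator (fun t : ℝ => (a n : ℂ) *
      (Complex.exp (-((β + Complex.I * (u * γ n : ℝ)) * t / γ n)) * (g n t : ℂ))) t := by
  unfold UU
  by_cases ht : 0 < t
  · rw [indicator_of_mem (by exact ht), indicator_of_mem (by exact ht)]
    have hγ' : (γ n : ℂ) ≠ 0 := by exact_mod_cast (S.γ_pos n).ne'
    have : -((β + Complex.I * (u * γ n : ℝ)) * t / γ n) = -(Complex.I * u * t) + (-(β * t) / γ n) := by
      push_cast; field_simp; ring
    rw [this, Complex.exp_add]
    push_cast; ring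
  · rw [indicator_of_notMem (by simpa using ht), indicator_of_notMem (by simpa using ht)]; simp

lemma ft_U (S : SU β lam0 σ0 bm a γ g G) (n : ℕ) (u : ℝ) :
    ft (UU β (a n) (γ n) (g n)) u = a n * ∫ t in Ioi (0:ℝ),
      Complex.exp (-((β + Complex.I * (u * γ n : ℝ)) * t / γ n)) * (g n t : ℂ) := by
  unfold ft
  simp_rw [S.U_ind]
  rw [integral_indicator measurableSet_Ioi, integral_const_mul]

lemma D_lim (S : SU β lam0 σ0 bm a γ g G) (ξ : ℝ) :
    Tendsto (fun n => (γ n : ℂ) * (1 - ft (UU β (a n) (γ n) (g n)) (ξ / γ n))) atTop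
      (nhds (bm + lam0 * σ0 * (β + Complex.I * ξ))) := by
  refine (S.lim_z (z := β + Complex.I * ξ) (by simp [S.hβ])).congr fun n => ?_
  rw [S.ft_U, div_mul_cancel₀ _ (S.γ_pos n).ne']

lemma U_int (S : SU β lam0 σ0 bm a γ g G) (n : ℕ) : Integrable (UU β (a n) (γ n) (g n)) := by
  unfold UU
  rw [integrable_indicator_iff measurableSet_Ioi]
  refine Integrable.const_mul ?_ _
  refine (S.g_int n).mono' ?_
    ((ae_restrict_iff' measurableSet_Ioi).mpr (Eventually.of_forall fun t ht => ?_))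
  · exact ((Continuous.measurable (by fun_prop)).mul (S.g_anti n).measurable).aestronglyMeasurable
  · have ht' : 0 < t := ht
    rw [Real.norm_eq_abs, abs_of_nonneg (mul_nonneg (Real.exp_pos _).le (S.g_nn n t))]
    refine mul_le_of_le_one_left (S.g_nn n t) ?_
    rw [Real.exp_le_one_iff]
    have := div_nonneg (mul_nonneg S.hβ ht'.le) (S.γ_pos n).le
    rw [neg_div]; linarith

lemma exp_le (S : SU β lam0 σ0 bm a γ g G) (n : ℕ) {t : ℝ} (ht : 0 < t) :
    Real.exp (-(β * t) / γ n) ≤ 1 := by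
  rw [Real.exp_le_one_iff]
  have := div_nonneg (mul_nonneg S.hβ ht.le) (S.γ_pos n).le
  rw [neg_div]; linarith

lemma U_nn (S : SU β lam0 σ0 bm a γ g G) (n : ℕ) (t : ℝ) : 0 ≤ UU β (a n) (γ n) (g n) t :=
  indicator_nonneg (fun t _ => mul_nonneg (S.a_pos n).le
    (mul_nonneg (Real.exp_pos _).le (S.g_nn n t))) t

lemma U_zero (n : ℕ) (t : ℝ) (ht : t ≤ 0) : UU β (a n) (γ n) (g n) t = 0 :=
  indicator_of_notMem (by simpa using ht) _

lemma U_bd (S : SU β lam0 σ0 bm a γ g G) (n : ℕ) (t : ℝ) : UU β (a n) (γ n) (g n) t ≤ a n := by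
  by_cases ht : 0 < t
  · unfold UU
    rw [indicator_of_mem (by exact ht)]
    refine mul_le_of_le_one_right (S.a_pos n).le ?_
    exact mul_le_one₀ (S.exp_le n ht) (S.g_nn n t) (S.g_le n t)
  · rw [U_zero n t (by linarith)]; exact (S.a_pos n).le

lemma U_dom (S : SU β lam0 σ0 bm a γ g G) (n : ℕ) (t : ℝ) (ht : 0 < t) :
    UU β (a n) (γ n) (g n) t ≤ a n * G t := by
  unfold UU
  rw [indicator_of_mem (by exact ht)]
  refine mul_le_mul_of_nonneg_left ?_ (S.a_pos n).le
  exact (mul_le_of_le_one_left (S.g_nn n t) (S.exp_le n ht)).trans (S.g_dom n t ht)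

lemma U_anti (S : SU β lam0 σ0 bm a γ g G) (n : ℕ) {s t : ℝ} (hs : 0 < s) (hst : s ≤ t) :
    UU β (a n) (γ n) (g n) t ≤ UU β (a n) (γ n) (g n) s := by
  unfold UU
  rw [indicator_of_mem (mem_Ioi.mpr hs), indicator_of_mem (mem_Ioi.mpr (hs.trans_le hst))]
  refine mul_le_mul_of_nonneg_left ?_ (S.a_pos n).le
  refine mul_le_mul ?_ (S.g_anti n hst) (S.g_nn n t) (Real.exp_pos _).le
  rw [Real.exp_le_exp]
  have := S.hβ
  have := S.γ_pos n
  gcongr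

lemma rho_lim (S : SU β lam0 σ0 bm a γ g G) :
    Tendsto (fun n => γ n * (1 - ∫ t, UU β (a n) (γ n) (g n) t)) atTop
      (nhds (bm + β * σ0 * lam0)) := by
  have h := (Complex.continuous_re.tendsto _).comp (S.D_lim 0)
  have e : ((bm:ℂ) + lam0 * σ0 * (β + Complex.I * (0:ℝ))).re = bm + β * σ0 * lam0 := by
    have : (bm:ℂ) + lam0 * σ0 * (β + Complex.I * (0:ℝ)) = ((bm + lam0 * σ0 * β : ℝ) : ℂ) := by
      push_cast; ring
    rw [this, Complex.ofReal_re]; ring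
  rw [e] at h
  refine h.congr fun n => ?_
  have : ft (UU β (a n) (γ n) (g n)) (0 / γ n) = ((∫ t, UU β (a n) (γ n) (g n) t : ℝ) : ℂ) := by
    unfold ft
    rw [← integral_complex_ofReal]
    simp
  simp only [Function.comp]
  rw [this]
  have : (γ n : ℂ) * (1 - ((∫ t, UU β (a n) (γ n) (g n) t : ℝ) : ℂ))
    = ((γ n * (1 - ∫ t, UU β (a n) (γ n) (g n) t) : ℝ) : ℂ) := by push_cast; ring
  rw [this, Complex.ofReal_re]

lemma good (S : SU β lam0 σ0 bm a γ g G) (n : ℕ) (h : ∫ t, UU β (a n) (γ n) (g n) t < 1) :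
    GoodU (UU β (a n) (γ n) (g n)) (a n) :=
  ⟨S.U_int n, S.U_nn n, U_zero n, S.U_bd n, h⟩

end SU

lemma abs_sub_sin_le (x : ℝ) : |x - Real.sin x| ≤ 2 * (|x| * min |x| 1) := by
  rcases le_total |x| 1 with h | h
  · rw [min_eq_left h]
    have h1 := Complex.norm_exp_sub_one_sub_id_le (x := x * Complex.I) (by simpa using h)
    have h2 := (Complex.abs_im_le_norm _).trans h1
    rw [Complex.exp_mul_I] at h2
    simp [← Complex.ofReal_cos, ← Complex.ofReal_sin] at h2
    rw [abs_sub_comm]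
    nlinarith [abs_nonneg x, sq_abs x]
  · rw [min_eq_right h]
    have := Real.abs_sin_le_one x
    calc _ ≤ |x| + |Real.sin x| := abs_sub _ _
      _ ≤ _ := by linarith

lemma ft_re {U : ℝ → ℝ} (hU : Integrable U) (u : ℝ) :
    (ft U u).re = ∫ t, Real.cos (u * t) * U t := by
  unfold ft
  have := integral_re (ft_integrand_integrable hU u)
  simp only [RCLike.re_to_complex] at this
  rw [← this]
  congr 1 with t
  have e : -(Complex.I * u * t) = ((-(u * t) : ℝ) : ℂ) * Complex.I := by push_cast; ring
  rw [e, Complex.re_mul_ofReal, Complex.exp_ofReal_mul_I_re, Real.cos_neg]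

lemma ft_im {U : ℝ → ℝ} (hU : Integrable U) (u : ℝ) :
    (ft U u).im = - ∫ t, Real.sin (u * t) * U t := by
  unfold ft
  have := integral_im (ft_integrand_integrable hU u)
  simp only [RCLike.im_to_complex] at this
  rw [← this, ← integral_neg]
  congr 1 with t
  have e : -(Complex.I * u * t) = ((-(u * t) : ℝ) : ℂ) * Complex.I := by push_cast; ring
  rw [e, Complex.im_mul_ofReal, Complex.exp_ofReal_mul_I_im, Real.sin_neg, neg_mul]

lemma trig_int {U : ℝ → ℝ} (hU : Integrable U) (u : ℝ) :
    Integrable (fun t => Real.cos (u * t) * U t) ∧ Integrable (fun t => Real.sin (u * t) * U t) :=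
  ⟨hU.bdd_mul (c := 1) (Continuous.aestronglyMeasurable (by fun_prop))
      (Eventually.of_forall fun t => Real.abs_cos_le_one _),
    hU.bdd_mul (c := 1) (Continuous.aestronglyMeasurable (by fun_prop))
      (Eventually.of_forall fun t => Real.abs_sin_le_one _)⟩

lemma one_sub_exp_le_min {x y : ℝ} (hxy : x ≤ y) : 1 - Real.exp (-x) ≤ min y 1 := by
  refine le_min ?_ ?_
  · linarith [Real.add_one_le_exp (-x)]
  · linarith [Real.exp_pos (-x)]

namespace SU

variable {β lam0 σ0 bm : ℝ} {a γ : ℕ → ℝ} {g : ℕ → ℝ → ℝ} {G : ℝ → ℝ}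

lemma G_nn (S : SU β lam0 σ0 bm a γ g G) {t : ℝ} (ht : 0 < t) : 0 ≤ G t :=
  (S.g_nn 0 t).trans (S.g_dom 0 t ht)

lemma tmG_int (S : SU β lam0 σ0 bm a γ g G) {ε : ℝ} (hε : 0 < ε) :
    IntegrableOn (fun t => min (ε * t) 1 * (t * G t)) (Ioi 0) := by
  refine S.tG_int.bdd_mul (c := 1) (Continuous.aestronglyMeasurable (by fun_prop)) ?_
  refine (ae_restrict_iff' measurableSet_Ioi).mpr (Eventually.of_forall fun t ht => ?_)
  have ht' : 0 < t := ht
  rw [Real.norm_eq_abs, abs_of_nonneg (by positivity)]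
  exact min_le_right _ _

lemma eps_exists (S : SU β lam0 σ0 bm a γ g G) {r : ℝ} (hr : 0 < r) :
    ∃ ε > 0, ∫ t in Ioi (0:ℝ), min (ε * t) 1 * (t * G t) ≤ r := by
  have h : Tendsto (fun n : ℕ => ∫ t in Ioi (0:ℝ), min ((1 / ((n:ℝ) + 1)) * t) 1 * (t * G t)) atTop
      (nhds (∫ t in Ioi (0:ℝ), (0:ℝ))) := by
    refine tendsto_integral_of_dominated_convergence (fun t => t * G t) ?_ S.tG_int ?_ ?_
    · intro n; exact (S.tmG_int (by positivity)).1
    · intro n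
      refine (ae_restrict_iff' measurableSet_Ioi).mpr (Eventually.of_forall fun t ht => ?_)
      have ht' : 0 < t := ht
      have := S.G_nn ht'
      rw [Real.norm_eq_abs, abs_of_nonneg (by positivity)]
      exact mul_le_of_le_one_left (by positivity) (min_le_right _ _)
    · refine Eventually.of_forall fun t => ?_
      have h1 : Tendsto (fun n : ℕ => min ((1 / ((n:ℝ) + 1)) * t) 1 * (t * G t)) atTop
          (nhds (min (0 * t) 1 * (t * G t))) :=
        ((tendsto_one_div_add_atTop_nhds_zero_nat.mul_const t).min tendsto_const_nhds).mul_const _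
      simpa using h1
  rw [integral_zero] at h
  obtain ⟨n, hn⟩ := (h.eventually_lt_const hr).exists
  exact ⟨1 / ((n:ℝ) + 1), by positivity, hn.le⟩

lemma low (S : SU β lam0 σ0 bm a γ g G) :
    ∃ ε > 0, ∀ᶠ n in atTop, ∀ u : ℝ, |u| ≤ ε →
      lam0 * σ0 / 4 * |u| ≤ ‖1 - ft (UU β (a n) (γ n) (g n)) u‖ := by
  have hl := S.hlam0
  have hs := S.hσ0
  obtain ⟨ε, hε, hI⟩ := S.eps_exists (r := σ0 / 24) (by positivity)
  refine ⟨ε, hε, ?_⟩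
  have e1 : ∀ᶠ n in atTop, a n < 2 * lam0 := S.a_lim.eventually_lt_const (by linarith)
  have e2 : ∀ᶠ n in atTop, lam0 * σ0 / 2 < a n * ∫ t in Ioi (0:ℝ), t * g n t :=
    (S.a_lim.mul S.lim2).eventually_const_lt (by nlinarith [mul_pos hl hs])
  have e3 : ∀ᶠ n in atTop, β / ε ≤ γ n := S.γ_top.eventually_ge_atTop _
  filter_upwards [e1, e2, e3] with n h1 h2 h3 u hu
  have hγ := S.γ_pos n
  have ha := S.a_pos n
  have hβ := S.hβ
  have h3' : β / γ n ≤ ε := by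
    rw [div_le_iff₀ hε] at h3
    rw [div_le_iff₀ hγ]; linarith
  have him : (1 - ft (UU β (a n) (γ n) (g n)) u).im
      = ∫ t, Real.sin (u * t) * UU β (a n) (γ n) (g n) t := by
    rw [Complex.sub_im, ft_im (S.U_int n)]; simp
  have hset : ∫ t, Real.sin (u * t) * UU β (a n) (γ n) (g n) t
      = ∫ t in Ioi (0:ℝ), Real.sin (u * t) * UU β (a n) (γ n) (g n) t := by
    rw [setIntegral_eq_integral_of_forall_compl_eq_zero]
    intro t ht
    rw [U_zero n t (by simpa using ht), mul_zero]
  have hdiff : |a n * u * (∫ t in Ioi (0:ℝ), t * g n t) -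
      ∫ t in Ioi (0:ℝ), Real.sin (u * t) * UU β (a n) (γ n) (g n) t| ≤
      ∫ t in Ioi (0:ℝ), (6 * lam0 * |u|) * (min (ε * t) 1 * (t * G t)) := by
    rw [← integral_const_mul, ← integral_sub ((S.tg_int n).const_mul _)
      (trig_int (S.U_int n) u).2.integrableOn, ← Real.norm_eq_abs]
    refine norm_integral_le_of_norm_le ((S.tmG_int hε).const_mul _) ?_
    refine (ae_restrict_iff' measurableSet_Ioi).mpr (Eventually.of_forall fun t ht => ?_)
    have ht' : 0 < t := ht
    have hU0 := S.U_nn n t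
    have hUd := S.U_dom n t ht'
    have hg := S.g_nn n t
    have hgd := S.g_dom n t ht'
    have hG := S.G_nn ht'
    have hm0 : 0 ≤ min (ε * t) 1 := by positivity
    have hUe : a n * g n t - UU β (a n) (γ n) (g n) t
        = a n * g n t * (1 - Real.exp (-(β * t / γ n))) := by
      unfold UU
      rw [indicator_of_mem ht, neg_div]; ring
    have hx : β * t / γ n ≤ ε * t := by
      have := mul_le_mul_of_nonneg_right h3' ht'.le
      calc _ = β / γ n * t := by ring
        _ ≤ _ := this
    have hmin := one_sub_exp_le_min hx
    have hexp0 : 0 ≤ 1 - Real.exp (-(β * t / γ n)) := by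
      have : Real.exp (-(β * t / γ n)) ≤ 1 := by
        rw [Real.exp_le_one_iff]; have : 0 ≤ β * t / γ n := by positivity
        linarith
      linarith
    have hsin : |u * t - Real.sin (u * t)| ≤ 2 * (|u| * t * min (ε * t) 1) := by
      refine (abs_sub_sin_le _).trans ?_
      rw [abs_mul, abs_of_pos ht']
      gcongr
    have hdec : a n * u * (t * g n t) - Real.sin (u * t) * UU β (a n) (γ n) (g n) t
        = u * t * (a n * g n t - UU β (a n) (γ n) (g n) t)
          + (u * t - Real.sin (u * t)) * UU β (a n) (γ n) (g n) t := by ring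
    rw [Real.norm_eq_abs, hdec]
    have b1 : |u * t * (a n * g n t - UU β (a n) (γ n) (g n) t)|
        ≤ |u| * t * (2 * lam0 * G t * min (ε * t) 1) := by
      rw [hUe, abs_mul, abs_mul u t, abs_of_pos ht',
        abs_of_nonneg (mul_nonneg (mul_nonneg ha.le hg) hexp0)]
      gcongr
    have b2 : |(u * t - Real.sin (u * t)) * UU β (a n) (γ n) (g n) t|
        ≤ 2 * (|u| * t * min (ε * t) 1) * (2 * lam0 * G t) := by
      rw [abs_mul, abs_of_nonneg hU0]
      have : UU β (a n) (γ n) (g n) t ≤ 2 * lam0 * G t :=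
        hUd.trans (mul_le_mul_of_nonneg_right h1.le hG)
      gcongr
    calc _ ≤ _ := (abs_add_le _ _).trans (add_le_add b1 b2)
      _ = _ := by ring
  rw [integral_const_mul] at hdiff
  have hI' : 6 * lam0 * |u| * ∫ t in Ioi (0:ℝ), min (ε * t) 1 * (t * G t)
      ≤ 6 * lam0 * |u| * (σ0 / 24) := mul_le_mul_of_nonneg_left hI (by positivity)
  have hk : lam0 * σ0 / 2 * |u| ≤ |a n * u * (∫ t in Ioi (0:ℝ), t * g n t)| := by
    have : a n * u * (∫ t in Ioi (0:ℝ), t * g n t) = (a n * ∫ t in Ioi (0:ℝ), t * g n t) * u := by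
      ring
    rw [this, abs_mul]
    exact mul_le_mul_of_nonneg_right (h2.le.trans (le_abs_self _)) (abs_nonneg _)
  have hfin := Complex.abs_im_le_norm (1 - ft (UU β (a n) (γ n) (g n)) u)
  rw [him, hset] at hfin
  have htri := abs_sub_abs_le_abs_sub (a n * u * (∫ t in Ioi (0:ℝ), t * g n t))
    (∫ t in Ioi (0:ℝ), Real.sin (u * t) * UU β (a n) (γ n) (g n) t)
  nlinarith

lemma mid (S : SU β lam0 σ0 bm a γ g G) :
    ∀ᶠ n in atTop, (∫ t, UU β (a n) (γ n) (g n) t < 1) ∧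
      ∀ u : ℝ, (bm + β * σ0 * lam0) / 2 ≤ γ n * ‖1 - ft (UU β (a n) (γ n) (g n)) u‖ := by
  have hc := S.hc
  filter_upwards [S.rho_lim.eventually_const_lt (show (bm + β * σ0 * lam0) / 2 < _ by linarith)]
    with n hn
  have hγ := S.γ_pos n
  have hlt : ∫ t, UU β (a n) (γ n) (g n) t < 1 := by
    by_contra hcon
    push Not at hcon
    nlinarith
  refine ⟨hlt, fun u => hn.le.trans (mul_le_mul_of_nonneg_left ?_ hγ.le)⟩
  have h1 := (S.good n hlt).norm_ft_le u
  have h2 := norm_sub_norm_le (1:ℂ) (ft (UU β (a n) (γ n) (g n)) u)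
  rw [norm_one] at h2
  linarith

lemma low_val (S : SU β lam0 σ0 bm a γ g G) :
    ∃ T > 0, ∃ δ > 0, ∀ᶠ n in atTop, δ ≤ UU β (a n) (γ n) (g n) T := by
  have hl := S.hlam0
  set T := 1 / (8 * lam0) with hT
  have hT0 : 0 < T := by positivity
  have hW : IntegrableOn (fun t => 2 * lam0 * G t) (Ioi 0) := S.G_int.const_mul _
  have htail : Tendsto (fun x : ℝ => ∫ t in Ioi x, 2 * lam0 * G t) atTop (nhds 0) :=
    tendsto_integral_Ioi_zero tendsto_id
  obtain ⟨X, hX1, hX2⟩ := ((htail.eventually_lt_const (show (0:ℝ) < 1 / 4 by norm_num)).and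
    (eventually_ge_atTop (T + 1))).exists
  have hXT : 0 < X - T := by linarith
  refine ⟨T, hT0, 1 / (4 * (X - T)), by positivity, ?_⟩
  have hrho : Tendsto (fun n => 1 - ∫ t, UU β (a n) (γ n) (g n) t) atTop (nhds 0) := by
    have := S.rho_lim.mul (tendsto_inv_atTop_zero.comp S.γ_top)
    rw [mul_zero] at this
    refine this.congr fun n => ?_
    have := (S.γ_pos n).ne'
    simp only [Function.comp]; field_simp
  have e1 : ∀ᶠ n in atTop, a n < 2 * lam0 := S.a_lim.eventually_lt_const (by linarith)
  filter_upwards [hrho.eventually_lt_const (show (0:ℝ) < 1 / 4 by norm_num), e1] with n h1 h2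
  have hU := S.U_int n
  have hsplit : ∫ t, UU β (a n) (γ n) (g n) t = (∫ t in Ioc 0 T, UU β (a n) (γ n) (g n) t)
      + (∫ t in Ioc T X, UU β (a n) (γ n) (g n) t) + ∫ t in Ioi X, UU β (a n) (γ n) (g n) t := by
    rw [← setIntegral_union (Ioc_disjoint_Ioc_of_le le_rfl) measurableSet_Ioc hU.integrableOn
      hU.integrableOn, Ioc_union_Ioc_eq_Ioc hT0.le (by linarith),
      ← setIntegral_union Ioc_disjoint_Ioi_same measurableSet_Ioi hU.integrableOn
      hU.integrableOn, Ioc_union_Ioi_eq_Ioi (by linarith),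
      setIntegral_eq_integral_of_forall_compl_eq_zero]
    intro t ht
    exact U_zero n t (by simpa using ht)
  have p1 : ∫ t in Ioc 0 T, UU β (a n) (γ n) (g n) t ≤ 1 / 4 := by
    calc _ ≤ ∫ t in Ioc 0 T, (2 * lam0) :=
          setIntegral_mono hU.integrableOn (integrableOn_const (by simp)) (fun t => (S.U_bd n t).trans h2.le)
      _ = 1 / 4 := by
          rw [setIntegral_const]; simp [hT0.le]; rw [hT]; field_simp; norm_num
  have p2 : ∫ t in Ioc T X, UU β (a n) (γ n) (g n) t ≤ (X - T) * UU β (a n) (γ n) (g n) T := by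
    calc _ ≤ ∫ t in Ioc T X, UU β (a n) (γ n) (g n) T :=
          setIntegral_mono_on hU.integrableOn (integrableOn_const (by simp)) measurableSet_Ioc
            (fun t ht => S.U_anti n hT0 ht.1.le)
      _ = _ := by rw [setIntegral_const, measureReal_def, Real.volume_Ioc,
          ENNReal.toReal_ofReal hXT.le, smul_eq_mul]
  have p3 : ∫ t in Ioi X, UU β (a n) (γ n) (g n) t ≤ 1 / 4 := by
    refine le_trans ?_ hX1.le
    refine setIntegral_mono_on hU.integrableOn (hW.mono_set (Ioi_subset_Ioi (by linarith)))
      measurableSet_Ioi fun t ht => ?_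
    have ht0 : 0 < t := by have : X < t := ht; linarith
    exact (S.U_dom n t ht0).trans (mul_le_mul_of_nonneg_right h2.le (S.G_nn ht0))
  rw [div_le_iff₀ (by positivity)]
  nlinarith

lemma high (S : SU β lam0 σ0 bm a γ g G) {ε : ℝ} (hε : 0 < ε) :
    ∃ δ > 0, ∀ᶠ n in atTop, ∀ u : ℝ, ε ≤ |u| → δ ≤ ‖1 - ft (UU β (a n) (γ n) (g n)) u‖ := by
  obtain ⟨T, hT, δ, hδ, hv⟩ := S.low_val
  set x0 := ε * T with hx0
  have hx0p : 0 < x0 := by positivity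
  have hs0 : 0 < x0 - Real.sin x0 := by linarith [Real.sin_lt hx0p]
  set d := min (1 / 2) ((x0 - Real.sin x0) / 2) with hd
  have hdp : 0 < d := by positivity
  have htrig : ∀ x, x0 ≤ x → d * x ≤ x - Real.sin x := by
    intro x hx
    rcases le_total x 2 with h | h
    · have h1 : Real.sin x - Real.sin x0 ≤ x - x0 := by
        have e := Real.sin_sub_sin x x0
        have h3 : Real.sin ((x - x0) / 2) ≤ (x - x0) / 2 := Real.sin_le (by linarith)
        have h4 : 0 ≤ (x - x0) / 2 := by linarith
        have h5 : |Real.sin ((x - x0) / 2)| ≤ |(x - x0) / 2| := Real.abs_sin_le_abs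
        have h6 := Real.abs_cos_le_one ((x + x0) / 2)
        rw [abs_of_nonneg h4] at h5
        have h7 : Real.sin ((x - x0) / 2) * Real.cos ((x + x0) / 2) ≤ (x - x0) / 2 := by
          refine (le_abs_self _).trans ?_
          rw [abs_mul]
          exact (mul_le_of_le_one_right (abs_nonneg _) h6).trans h5
        linarith
      have h2 : d ≤ (x0 - Real.sin x0) / 2 := min_le_right _ _
      nlinarith
    · have h1 := Real.sin_le_one x
      have h2 : d ≤ 1 / 2 := min_le_left _ _
      nlinarith
  refine ⟨δ * (d * T), by positivity, ?_⟩
  filter_upwards [hv, S.mid] with n hn hm u hu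
  have hU := S.U_int n
  have hu0 : 0 < |u| := hε.trans_le hu
  have hu1 : u ≠ 0 := abs_pos.mp hu0
  refine le_trans ?_ ((le_abs_self _).trans (Complex.abs_re_le_norm _))
  rw [Complex.sub_re, ft_re hU, Complex.one_re]
  have hint : Integrable (fun t => (1 - Real.cos (u * t)) * UU β (a n) (γ n) (g n) t) := by
    have := hU.sub (trig_int hU u).1
    refine this.congr (Eventually.of_forall fun t => ?_)
    simp only [Pi.sub_apply]; ring
  have h1 : ∫ t, (1 - Real.cos (u * t)) * UU β (a n) (γ n) (g n) t
      ≤ 1 - ∫ t, Real.cos (u * t) * UU β (a n) (γ n) (g n) t := by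
    have : ∫ t, (1 - Real.cos (u * t)) * UU β (a n) (γ n) (g n) t
      = (∫ t, UU β (a n) (γ n) (g n) t) - ∫ t, Real.cos (u * t) * UU β (a n) (γ n) (g n) t := by
      rw [← integral_sub hU (trig_int hU u).1]
      congr 1 with t; ring
    linarith [hm.1]
  refine le_trans ?_ h1
  have hcos : ∀ t, 0 ≤ 1 - Real.cos (u * t) := fun t => by linarith [Real.cos_le_one (u * t)]
  have hcint : ∫ t in Ioc 0 T, (1 - Real.cos (u * t)) = T - Real.sin (u * T) / u := by
    rw [← intervalIntegral.integral_of_le hT.le, intervalIntegral.integral_sub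
      (by simp) (Continuous.intervalIntegrable (by fun_prop) _ _),
      intervalIntegral.integral_comp_mul_left (fun x => Real.cos x) hu1]
    simp [integral_cos]
    field_simp
  have hcl : d * T ≤ T - Real.sin (u * T) / u := by
    have h2 := htrig (|u| * T) (by rw [hx0]; gcongr)
    have h3 : Real.sin (u * T) / u = Real.sin (|u| * T) / |u| := by
      rcases abs_cases u with ⟨h, _⟩ | ⟨h, _⟩
      · rw [h]
      · rw [h, neg_mul, Real.sin_neg, neg_div_neg_eq]
    rw [h3, le_sub_iff_add_le, ← le_sub_iff_add_le', div_le_iff₀ hu0]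
    nlinarith
  calc δ * (d * T) ≤ δ * ∫ t in Ioc 0 T, (1 - Real.cos (u * t)) := by
        rw [hcint]; exact mul_le_mul_of_nonneg_left hcl hδ.le
    _ = ∫ t in Ioc 0 T, (1 - Real.cos (u * t)) * δ := by rw [integral_mul_const, mul_comm]
    _ ≤ ∫ t in Ioc 0 T, (1 - Real.cos (u * t)) * UU β (a n) (γ n) (g n) t := by
        refine setIntegral_mono_on ?_ hint.integrableOn measurableSet_Ioc fun t ht => ?_
        · exact (Continuous.integrableOn_Icc (by fun_prop)).mono_set Ioc_subset_Icc_self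
        · exact mul_le_mul_of_nonneg_left (hn.trans (S.U_anti n ht.1 ht.2)) (hcos t)
    _ ≤ _ := setIntegral_le_integral hint
        (Eventually.of_forall fun t => mul_nonneg (hcos t) (S.U_nn n t))

end SU

noncomputable def PP (y : ℝ) (z : ℂ) : ℂ := ∫ t in (0:ℝ)..y, Complex.exp (-(z * t))

lemma PP_cont (y : ℝ) : Continuous (PP y) := by
  unfold PP
  refine intervalIntegral.continuous_parametric_intervalIntegral_of_continuous' ?_ _ _
  fun_prop

lemma PP_zero (y : ℝ) : PP y 0 = y := by simp [PP]

lemma PP_bd1 {y : ℝ} (hy : 0 ≤ y) {z : ℂ} (hz : 0 ≤ z.re) : ‖PP y z‖ ≤ y := by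
  have := intervalIntegral.norm_integral_le_of_norm_le_const (a := 0) (b := y) (C := 1)
    (f := fun t : ℝ => Complex.exp (-(z * t))) (fun t ht => ?_)
  · simpa [PP, abs_of_nonneg hy] using this
  · rw [uIoc_of_le hy] at ht
    rw [Complex.norm_exp, Real.exp_le_one_iff, Complex.neg_re, Complex.re_mul_ofReal]
    have := mul_nonneg hz ht.1.le
    linarith

lemma PP_bd2 {y : ℝ} (hy : 0 ≤ y) {z : ℂ} (hz : 0 ≤ z.re) : ‖PP y z‖ * |z.im| ≤ 2 := by
  by_cases h0 : z = 0
  · simp [h0]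
  have e : PP y z = (Complex.exp (-z * y) - 1) / (-z) := by
    unfold PP
    have := integral_exp_mul_complex (a := 0) (b := y) (c := -z) (neg_ne_zero.mpr h0)
    simp only [neg_mul] at this ⊢
    rw [this]; simp
  have h1 : ‖Complex.exp (-z * y)‖ ≤ 1 := by
    rw [Complex.norm_exp, Real.exp_le_one_iff, Complex.re_mul_ofReal, Complex.neg_re]
    have := mul_nonneg hz hy
    linarith
  rw [e, norm_div, norm_neg]
  have hz0 : 0 < ‖z‖ := norm_pos_iff.mpr h0
  rw [div_mul_eq_mul_div, div_le_iff₀ hz0]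
  have h2 : ‖Complex.exp (-z * y) - 1‖ ≤ 2 := by
    refine (norm_sub_le _ _).trans ?_
    rw [norm_one]; linarith
  exact mul_le_mul h2 (Complex.abs_im_le_norm z) (abs_nonneg _) (by norm_num)

lemma hh_eq (lamn γn β : ℝ) {k : ℕ} (y : Fin k → ℝ) (t : ℝ) :
    hh lamn γn β y t = ∑ j, (Ioo 0 (y j)).indicator
      (fun s => lamn * Real.exp (-(β * s) / γn)) t := by
  unfold hh
  by_cases ht : 0 < t
  · rw [indicator_of_mem (mem_Ioi.mpr ht), Finset.mul_sum, Finset.mul_sum]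
    refine Finset.sum_congr rfl fun j _ => ?_
    by_cases h : t < y j
    · rw [indicator_of_mem (mem_Ioo.mpr ⟨ht, h⟩)]; simp [h]
    · rw [indicator_of_notMem (by simp [h])]; simp [h]
  · rw [indicator_of_notMem (by simpa using ht)]
    symm
    refine Finset.sum_eq_zero fun j _ => ?_
    rw [indicator_of_notMem (by simp [ht])]

lemma hh_int (lamn γn β : ℝ) {k : ℕ} (y : Fin k → ℝ) : Integrable (hh lamn γn β y) := by
  have : hh lamn γn β y = fun t => ∑ j, (Ioo 0 (y j)).indicator
      (fun s => lamn * Real.exp (-(β * s) / γn)) t := funext fun t => hh_eq lamn γn β y t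
  rw [this]
  refine integrable_finsetSum _ fun j _ => ?_
  rw [integrable_indicator_iff measurableSet_Ioo]
  exact (Continuous.integrableOn_Icc (by fun_prop)).mono_set Ioo_subset_Icc_self

lemma ft_hh (lamn γn β : ℝ) {k : ℕ} (y : Fin k → ℝ) (hy : ∀ j, 0 ≤ y j) (u : ℝ) :
    ft (hh lamn γn β y) u = lamn * ∑ j, PP (y j) ((β / γn : ℝ) + Complex.I * u) := by
  unfold ft
  have h1 : ∀ t : ℝ, Complex.exp (-(Complex.I * u * t)) * (hh lamn γn β y t : ℂ)
      = ∑ j, (Ioo 0 (y j)).indicator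
        (fun s : ℝ => (lamn : ℂ) * Complex.exp (-(((β / γn : ℝ) + Complex.I * u) * s))) t := by
    intro t
    rw [hh_eq]
    push_cast
    rw [Finset.mul_sum]
    refine Finset.sum_congr rfl fun j _ => ?_
    by_cases h : t ∈ Ioo 0 (y j)
    · rw [indicator_of_mem h, indicator_of_mem h]
      push_cast
      rw [mul_left_comm, ← Complex.exp_add]
      congr 2; ring
    · rw [indicator_of_notMem h, indicator_of_notMem h]; simp
  simp_rw [h1]
  rw [integral_finsetSum, Finset.mul_sum]
  · refine Finset.sum_congr rfl fun j _ => ?_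
    rw [integral_indicator measurableSet_Ioo, integral_const_mul, ← integral_Ioc_eq_integral_Ioo,
      ← intervalIntegral.integral_of_le (hy j)]
    rfl
  · intro j _
    rw [integrable_indicator_iff measurableSet_Ioo]
    exact (Continuous.integrableOn_Icc (by fun_prop)).mono_set Ioo_subset_Icc_self

lemma hh_nn {lamn : ℝ} (hl : 0 ≤ lamn) (γn β : ℝ) {k : ℕ} (y : Fin k → ℝ) (t : ℝ) :
    0 ≤ hh lamn γn β y t := by
  rw [hh_eq]
  exact Finset.sum_nonneg fun j _ => indicator_nonneg (fun s _ => by positivity) t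

lemma hh_le {lamn γn β : ℝ} (hl : 0 ≤ lamn) (hγ : 0 < γn) (hβ : 0 ≤ β) {k : ℕ} (y : Fin k → ℝ)
    (t : ℝ) : hh lamn γn β y t ≤ k * lamn := by
  rw [hh_eq]
  have : ∑ j : Fin k, lamn = k * lamn := by simp
  rw [← this]
  refine Finset.sum_le_sum fun j _ => ?_
  refine indicator_le' (fun s hs => ?_) (fun _ _ => hl) t
  refine mul_le_of_le_one_right hl ?_
  rw [Real.exp_le_one_iff, neg_div]
  have : 0 ≤ β * s / γn := div_nonneg (mul_nonneg hβ hs.1.le) hγ.le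
  linarith

lemma hh_zero (lamn γn β : ℝ) {k : ℕ} (y : Fin k → ℝ) (t : ℝ) (ht : t ≤ 0) :
    hh lamn γn β y t = 0 := indicator_of_notMem (by simpa using ht) _

lemma hh_zero' (lamn γn β : ℝ) {k : ℕ} (y : Fin k → ℝ) {Y : ℝ} (hY : ∀ j, y j ≤ Y) (t : ℝ)
    (ht : Y ≤ t) : hh lamn γn β y t = 0 := by
  rw [hh_eq]
  refine Finset.sum_eq_zero fun j _ => indicator_of_notMem ?_ _
  simp only [mem_Ioo, not_and, not_lt]
  intro _
  exact (hY j).trans ht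

lemma ft_cont {f : ℝ → ℝ} (hf : Integrable f) : Continuous (ft f) := by
  unfold ft
  refine continuous_of_dominated (bound := fun t => |f t|)
    (fun u => (ft_integrand_integrable hf u).1) (fun u => ?_) hf.abs
    (Eventually.of_forall fun t => by fun_prop)
  refine Eventually.of_forall fun t => ?_
  have e : -(Complex.I * u * t) = ((-(u * t) : ℝ) : ℂ) * Complex.I := by push_cast; ring
  rw [norm_mul, e, Complex.norm_exp_ofReal_mul_I, one_mul, Complex.norm_real, Real.norm_eq_abs]

namespace SU

variable {β lam0 σ0 bm : ℝ} {a γ : ℕ → ℝ} {g : ℕ → ℝ → ℝ} {G : ℝ → ℝ}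

lemma q_bd (S : SU β lam0 σ0 bm a γ g G) {lam : ℕ → ℝ} (hlp : ∀ n, 0 < lam n)
    (hlim : Tendsto lam atTop (nhds lam0)) {k : ℕ} (y : Fin k → ℝ) (hy : ∀ j, 0 ≤ y j) :
    ∃ K1 K2 : ℝ, ∀ᶠ n in atTop, ∀ w : ℝ,
      ‖(γ n : ℂ)⁻¹ * (ft (hh (lam n) (γ n) β y) (2 * Real.pi * w / γ n) *
        (1 - ft (UU β (a n) (γ n) (g n)) (2 * Real.pi * w / γ n))⁻¹)‖ ≤ K1 ∧
      ‖(γ n : ℂ)⁻¹ * (ft (hh (lam n) (γ n) β y) (2 * Real.pi * w / γ n) *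
        (1 - ft (UU β (a n) (γ n) (g n)) (2 * Real.pi * w / γ n))⁻¹)‖ * |w| ≤ K2 := by
  obtain ⟨ε, hε, hlow⟩ := S.low
  obtain ⟨δ, hδ, hhigh⟩ := S.high hε
  have hl0 := S.hlam0
  have hs0 := S.hσ0
  have hc := S.hc
  set c2 := (bm + β * σ0 * lam0) / 2 with hc2
  have hc2p : 0 < c2 := by positivity
  set Y := ∑ j, y j with hYd
  have hY : 0 ≤ Y := Finset.sum_nonneg fun j _ => hy j
  set s := lam0 * σ0 / 4 with hs
  have hsp : 0 < s := by positivity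
  refine ⟨2 * lam0 * Y / c2, 2 * lam0 * Y / s + 2 * lam0 * (k * 2) / δ, ?_⟩
  have e1 : ∀ᶠ n in atTop, lam n < 2 * lam0 := hlim.eventually_lt_const (by linarith)
  filter_upwards [e1, hlow, hhigh, S.mid] with n h1 h2 h3 h4 w
  set u := 2 * Real.pi * w / γ n with hu
  have hγ := S.γ_pos n
  set N := ‖1 - ft (UU β (a n) (γ n) (g n)) u‖ with hN
  have hmid := h4.2 u
  have hNp : 0 < N := by
    by_contra hcon
    push Not at hcon
    nlinarith [mul_nonneg hγ.le (norm_nonneg (1 - ft (UU β (a n) (γ n) (g n)) u))]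
  set H := ‖ft (hh (lam n) (γ n) β y) u‖ with hH
  have hH0 : 0 ≤ H := norm_nonneg _
  have hz : 0 ≤ (((β / γ n : ℝ) : ℂ) + Complex.I * u).re := by
    simp only [Complex.add_re, Complex.ofReal_re, Complex.re_mul_ofReal, Complex.I_re, zero_mul,
      add_zero]
    exact div_nonneg S.hβ hγ.le
  have hzi : (((β / γ n : ℝ) : ℂ) + Complex.I * u).im = u := by
    simp only [Complex.add_im, Complex.ofReal_im, Complex.im_mul_ofReal, Complex.I_im, one_mul,
      zero_add]
  have hHe : H = lam n * ‖∑ j, PP (y j) ((β / γ n : ℝ) + Complex.I * u)‖ := by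
    rw [hH, ft_hh _ _ _ _ hy, norm_mul, Complex.norm_real, Real.norm_eq_abs, abs_of_pos (hlp n)]
  have hb1 : H ≤ 2 * lam0 * Y := by
    rw [hHe]
    refine mul_le_mul h1.le ?_ (norm_nonneg _) (by positivity)
    exact (norm_sum_le _ _).trans (Finset.sum_le_sum fun j _ => PP_bd1 (hy j) hz)
  have hb2 : H * |u| ≤ 2 * lam0 * (k * 2) := by
    rw [hHe, mul_assoc]
    refine mul_le_mul h1.le ?_ (by positivity) (by positivity)
    refine (mul_le_mul_of_nonneg_right (norm_sum_le _ _) (abs_nonneg _)).trans ?_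
    rw [Finset.sum_mul]
    have : ∑ j : Fin k, (2:ℝ) = k * 2 := by simp
    rw [← this]
    refine Finset.sum_le_sum fun j _ => ?_
    have := PP_bd2 (hy j) hz
    rwa [hzi] at this
  have hq : ‖(γ n : ℂ)⁻¹ * (ft (hh (lam n) (γ n) β y) u *
        (1 - ft (UU β (a n) (γ n) (g n)) u)⁻¹)‖ = H / (γ n * N) := by
    rw [norm_mul, norm_mul, norm_inv, norm_inv, Complex.norm_real, Real.norm_eq_abs, abs_of_pos hγ,
      ← hH, ← hN]
    field_simp
  rw [hq]
  constructor
  · exact div_le_div₀ (by positivity) hb1 hc2p hmid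
  · have hw : |w| ≤ γ n * |u| := by
      rw [hu, abs_div, abs_mul, abs_of_pos (by positivity : (0:ℝ) < 2 * Real.pi), abs_of_pos hγ]
      have : γ n * (2 * Real.pi * |w| / γ n) = 2 * Real.pi * |w| := by field_simp
      rw [this]
      nlinarith [Real.pi_gt_three, abs_nonneg w]
    calc H / (γ n * N) * |w| ≤ H / (γ n * N) * (γ n * |u|) :=
          mul_le_mul_of_nonneg_left hw (by positivity)
      _ = H * |u| / N := by field_simp
      _ ≤ _ := by
        rcases le_total |u| ε with hue | hue
        · have hN2 := h2 u hue
          have : H * |u| / N ≤ 2 * lam0 * Y / s := by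
            rw [div_le_div_iff₀ hNp hsp]
            calc H * |u| * s = H * (s * |u|) := by ring
              _ ≤ (2 * lam0 * Y) * N := mul_le_mul hb1 hN2 (by positivity) (by positivity)
          have h0 : 0 ≤ 2 * lam0 * (k * 2) / δ := by positivity
          linarith
        · have hN2 := h3 u hue
          have : H * |u| / N ≤ 2 * lam0 * (k * 2) / δ :=
            div_le_div₀ (by positivity) hb2 hδ hN2
          have h0 : 0 ≤ 2 * lam0 * Y / s := by positivity
          linarith

lemma q_lim (S : SU β lam0 σ0 bm a γ g G) {lam : ℕ → ℝ}
    (hlim : Tendsto lam atTop (nhds lam0)) {k : ℕ} (y : Fin k → ℝ) (hy : ∀ j, 0 ≤ y j) (w : ℝ) :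
    Tendsto (fun n => (γ n : ℂ)⁻¹ * (ft (hh (lam n) (γ n) β y) (2 * Real.pi * w / γ n) *
        (1 - ft (UU β (a n) (γ n) (g n)) (2 * Real.pi * w / γ n))⁻¹)) atTop
      (nhds (((1 / σ0 * ∑ j, y j : ℝ) : ℂ) / (((bm / (σ0 * lam0) + β : ℝ) : ℂ)
        + Complex.I * (2 * Real.pi * w : ℝ)))) := by
  set ξ := 2 * Real.pi * w with hξ
  have hl0 := S.hlam0
  have hs0 := S.hσ0
  have hD := S.D_lim ξ
  have hγi : Tendsto (fun n => (γ n)⁻¹) atTop (nhds 0) := tendsto_inv_atTop_zero.comp S.γ_top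
  have hzlim : Tendsto (fun n => ((β / γ n : ℝ) : ℂ) + Complex.I * (ξ / γ n : ℝ)) atTop (nhds 0) := by
    have h1 : Tendsto (fun n => β / γ n) atTop (nhds 0) := by
      simpa [div_eq_mul_inv] using hγi.const_mul β
    have h2 : Tendsto (fun n => ξ / γ n) atTop (nhds 0) := by
      simpa [div_eq_mul_inv] using hγi.const_mul ξ
    have h1' := (Complex.continuous_ofReal.tendsto 0).comp h1
    have h2' := ((Complex.continuous_ofReal.tendsto 0).comp h2).const_mul Complex.I
    simpa using h1'.add h2'
  have hH : Tendsto (fun n => ft (hh (lam n) (γ n) β y) (ξ / γ n)) atTop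
      (nhds ((lam0 : ℂ) * ∑ j, (y j : ℂ))) := by
    have h1 : ∀ j, Tendsto (fun n => PP (y j) (((β / γ n : ℝ) : ℂ) + Complex.I * (ξ / γ n : ℝ)))
        atTop (nhds (y j : ℂ)) := by
      intro j
      have := ((PP_cont (y j)).tendsto 0).comp hzlim
      rwa [PP_zero] at this
    have h2 := ((Complex.continuous_ofReal.tendsto _).comp hlim).mul
      (tendsto_finsetSum Finset.univ fun j _ => h1 j)
    refine h2.congr fun n => ?_
    rw [ft_hh _ _ _ _ hy]; rfl
  have hDne : ((bm:ℂ) + lam0 * σ0 * (β + Complex.I * ξ)) ≠ 0 := by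
    intro h0
    have := congrArg Complex.re h0
    have e : ((bm:ℂ) + lam0 * σ0 * (β + Complex.I * ξ))
        = ((bm + β * σ0 * lam0 : ℝ) : ℂ) + ((lam0 * σ0 * ξ : ℝ) : ℂ) * Complex.I := by
      push_cast; ring
    rw [e] at this
    simp only [Complex.add_re, Complex.ofReal_re, Complex.re_ofReal_mul, Complex.I_re, mul_zero,
      add_zero, Complex.zero_re] at this
    linarith [S.hc]
  have hfin := hH.mul (hD.inv₀ hDne)
  have elim : (lam0 : ℂ) * ∑ j, (y j : ℂ) * 1 = (lam0 : ℂ) * ∑ j, (y j : ℂ) := by simp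
  have e2 : (lam0 : ℂ) * (∑ j, (y j : ℂ)) * ((bm:ℂ) + lam0 * σ0 * (β + Complex.I * ξ))⁻¹
      = ((1 / σ0 * ∑ j, y j : ℝ) : ℂ) / (((bm / (σ0 * lam0) + β : ℝ) : ℂ) + Complex.I * ξ) := by
    have hl : (lam0 : ℂ) ≠ 0 := by exact_mod_cast hl0.ne'
    have hs : (σ0 : ℂ) ≠ 0 := by exact_mod_cast hs0.ne'
    have e3 : (((bm / (σ0 * lam0) + β : ℝ) : ℂ) + Complex.I * ξ)
        = ((bm:ℂ) + lam0 * σ0 * (β + Complex.I * ξ)) / (σ0 * lam0) := by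
      push_cast; field_simp; ring
    rw [e3]
    push_cast
    field_simp
  rw [e2] at hfin
  refine hfin.congr fun n => ?_
  rw [mul_inv]; ring

theorem main (S : SU β lam0 σ0 bm a γ g G) {lam : ℕ → ℝ} (hlp : ∀ n, 0 < lam n)
    (hlim : Tendsto lam atTop (nhds lam0)) {k : ℕ} (y : Fin k → ℝ) (hy : ∀ j, 0 ≤ y j)
    {κ : ℝ} (hκ : 1 ≤ κ) :
    Tendsto (fun n => ∫ t in Ioi (0:ℝ),
      |Kf (hh (lam n) (γ n) β y) (UU β (a n) (γ n) (g n)) (γ n * t) -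
        (1 / σ0) * (∑ j, y j) * Real.exp (-(bm / (σ0 * lam0) + β) * t)| ^ (2 * κ))
      atTop (nhds 0) := by
  have hl0 := S.hlam0
  have hs0 := S.hσ0
  have hcp : 0 < bm / (σ0 * lam0) + β := by
    have : bm / (σ0 * lam0) + β = (bm + β * σ0 * lam0) / (σ0 * lam0) := by field_simp
    rw [this]; exact div_pos S.hc (by positivity)
  obtain ⟨K1, K2, hK⟩ := S.q_bd hlp hlim y hy
  set q : ℕ → ℝ → ℂ := fun n w =>
    (γ n : ℂ)⁻¹ * (ft (hh (lam n) (γ n) β y) (2 * Real.pi * w / γ n) *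
        (1 - ft (UU β (a n) (γ n) (g n)) (2 * Real.pi * w / γ n))⁻¹) with hq
  set Lw : ℝ → ℂ := fun w => ((1 / σ0 * ∑ j, y j : ℝ) : ℂ) / (((bm / (σ0 * lam0) + β : ℝ) : ℂ)
        + Complex.I * (2 * Real.pi * w : ℝ)) with hLw
  have hql : ∀ w, Tendsto (fun n => q n w) atTop (nhds (Lw w)) := fun w => S.q_lim hlim y hy w
  have hLb : ∀ w, ‖Lw w‖ ≤ K1 ∧ ‖Lw w‖ * |w| ≤ K2 := by
    intro w
    constructor
    · exact le_of_tendsto (hql w).norm (hK.mono fun n hn => (hn w).1)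
    · exact le_of_tendsto ((hql w).norm.mul_const _) (hK.mono fun n hn => (hn w).2)
  have hLm : Measurable Lw := by
    rw [hLw]; exact Measurable.div measurable_const (Continuous.measurable (by fun_prop))
  have hqm : ∀ n, Measurable (q n) := by
    intro n
    have m1 : Measurable fun w : ℝ => 2 * Real.pi * w / γ n := Continuous.measurable (by fun_prop)
    have m2 := (ft_cont (hh_int (lam n) (γ n) β y)).measurable.comp m1
    have m3 := (ft_cont (S.U_int n)).measurable.comp m1
    exact (m2.mul (m3.const_sub 1).inv).const_mul _
  have hdct : Tendsto (fun n => ∫ w, ‖q n w - Lw w‖ ^ 2) atTop (nhds 0) := by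
    have e0 : (0:ℝ) = ∫ w : ℝ, (0:ℝ) := by simp
    rw [e0]
    refine tendsto_integral_filter_of_dominated_convergence
      (fun w => (4 * K1 ^ 2 + 4 * K2 ^ 2) * (1 + w ^ 2)⁻¹) ?_ ?_
      (integrable_inv_one_add_sq.const_mul _) ?_
    · exact Eventually.of_forall fun n =>
        ((((hqm n).sub hLm).norm).pow_const 2).aestronglyMeasurable
    · filter_upwards [hK] with n hn
      refine Eventually.of_forall fun w => ?_
      obtain ⟨a1, a2⟩ := hn w
      obtain ⟨b1, b2⟩ := hLb w
      rw [Real.norm_eq_abs, abs_of_nonneg (by positivity), ← div_eq_mul_inv,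
        le_div_iff₀ (by positivity)]
      have t1 : ‖q n w - Lw w‖ ≤ 2 * K1 := (norm_sub_le _ _).trans (by linarith)
      have t2 : ‖q n w - Lw w‖ * |w| ≤ 2 * K2 := by
        refine (mul_le_mul_of_nonneg_right (norm_sub_le _ _) (abs_nonneg _)).trans ?_
        rw [add_mul]; linarith
      have s1 := pow_le_pow_left₀ (norm_nonneg _) t1 2
      have s2 := pow_le_pow_left₀ (by positivity) t2 2
      rw [mul_pow, sq_abs] at s2
      nlinarith
    · refine Eventually.of_forall fun w => ?_
      have := (((hql w).sub_const (Lw w)).norm).pow 2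
      simpa using this
  set Y := ∑ j, y j with hYd
  have hYj : ∀ j, y j ≤ Y := fun j => Finset.single_le_sum (fun i _ => hy i) (Finset.mem_univ j)
  set L := 1 / (4 * lam0) with hL
  have hLp : 0 < L := by positivity
  obtain ⟨N, hN⟩ := exists_nat_ge (Y / L)
  have hN' : Y ≤ N * L := by rwa [div_le_iff₀ hLp] at hN
  set B := k * (2 * lam0) + k * (2 * lam0) * (2 * N) with hB
  have hup := hdct.const_mul ((B + |1 / σ0 * Y|) ^ (2 * κ - 2))
  rw [mul_zero] at hup
  refine squeeze_zero' ?_ ?_ hup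
  · exact Eventually.of_forall fun n =>
      integral_nonneg fun t => Real.rpow_nonneg (abs_nonneg _) _
  · have e1 : ∀ᶠ n in atTop, lam n < 2 * lam0 := hlim.eventually_lt_const (by linarith)
    have e2 : ∀ᶠ n in atTop, a n < 2 * lam0 := S.a_lim.eventually_lt_const (by linarith)
    filter_upwards [e1, e2, S.mid] with n h1 h2 h3
    have hgood := S.good n h3.1
    have haL : a n * L ≤ 1 / 2 := by
      rw [hL, mul_one_div, div_le_iff₀ (by positivity)]; linarith
    refine main_bound hgood (hh_int _ _ _ _) (hh_nn (hlp n).le _ _ _) (hh_zero _ _ _ _)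
      (fun t => ?_) (S.γ_pos n) hcp hκ
    refine Kf_le hgood (hh_nn (hlp n).le _ _ _) (fun t => ?_) (hh_zero _ _ _ _)
      (hh_zero' _ _ _ _ hYj) hLp.le haL N hN' t
    refine (hh_le (hlp n).le (S.γ_pos n) S.hβ y t).trans ?_
    gcongr

end SU

theorem stmt17
    (β α : ℝ) (hβ : 0 ≤ β) (hα : α ∈ Set.Ioo (1:ℝ) 2)
    (Λ : ℕ → Measure ℝ) (hΛprob : ∀ n, IsProbabilityMeasure (Λ n))
    (hΛsupp : ∀ n, Λ n (Set.Iio 0) = 0)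
    (lam m γ : ℕ → ℝ)
    (hlam_pos : ∀ n, 0 < lam n) (hm_pos : ∀ n, 0 < m n) (hγ_pos : ∀ n, 0 < γ n)
    (hγ_top : Tendsto γ atTop atTop)
    (Λbar : ℕ → ℝ → ℝ) (hΛbar : ∀ n t, Λbar n t = (Λ n (Set.Ioi t)).toReal)
    (Λbarβ : ℕ → ℝ → ℝ)
    (hΛbarβ : ∀ n t, Λbarβ n t = Real.exp (-(β * t) / γ n) * Λbar n t)
    (ηβ : ℕ → ℝ) (hηβ : ∀ n, ηβ n = ∫ t in Set.Ioi (0:ℝ), Λbarβ n t)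
    (lam0 η0 σ0 bm : ℝ) (hlam0 : 0 < lam0) (hη0 : 0 < η0) (hσ0 : 0 < σ0)
    (hbm_pos : 0 < bm + β * σ0 * lam0)
    (hmom1 : ∀ n, Integrable (fun t => t) (Λ n))
    (hmom2 : ∀ n, Integrable (fun t => t ^ 2) (Λ n))
    (hlam_lim : Tendsto lam atTop (nhds lam0))
    (hm_lim : Tendsto m atTop (nhds 1))
    (hmean_lim : Tendsto (fun n => ∫ t, t ∂(Λ n)) atTop (nhds η0))
    (hsec_lim : Tendsto (fun n => (1/2) * ∫ t, t ^ 2 ∂(Λ n)) atTop (nhds σ0))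
    (hγ_lim : Tendsto (fun n => γ n * (1 - lam n * m n * ∫ t, t ∂(Λ n))) atTop (nhds bm))
    (C₀ : ℝ) (hC₀ : 0 < C₀)
    (Λstar : Measure ℝ) (hstar_prob : IsProbabilityMeasure Λstar)
    (hstar_supp : Λstar (Set.Iio 0) = 0)
    (hstar_mom : Integrable (fun t => t ^ (2 * α)) Λstar)
    (hdom : ∀ n, ∀ t : ℝ, 0 ≤ t → Λbar n t ≤ C₀ * (Λstar (Set.Ioi t)).toReal)
    (Rβ : ℕ → ℝ → ℝ) (hRβ : ∀ n t, Rβ n t = resolventFn (lam n * m n) (Λbarβ n) t)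
 :
    ∀ κ : ℝ, 1 ≤ κ → ∀ k : ℕ, 1 ≤ k → ∀ y : Fin k → ℝ, (∀ j, 0 ≤ y j) →
      Tendsto (fun n => ∫ t in Set.Ioi (0:ℝ),
          |resolventK (lam n) (γ n) β (Rβ n) y (γ n * t) -
            (1 / σ0) * (∑ j, y j) * Real.exp (-(bm / (σ0 * lam0) + β) * t)| ^ (2 * κ))
        atTop (nhds 0) := by
  intro κ hκ k _ y hy
  obtain ⟨hG1, hG2⟩ := star_mom Λstar hstar_supp hα.1 hstar_mom
  have hbareq : ∀ n, Λbar n = fun t => (Λ n (Ioi t)).toReal := fun n => funext (hΛbar n)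
  have S : SU β lam0 σ0 bm (fun n => lam n * m n) γ Λbar
      (fun t => C₀ * (Λstar (Ioi t)).toReal) :=
    { hβ := hβ
      hlam0 := hlam0
      hσ0 := hσ0
      hc := hbm_pos
      a_pos := fun n => mul_pos (hlam_pos n) (hm_pos n)
      γ_pos := hγ_pos
      a_lim := by simpa using hlam_lim.mul hm_lim
      γ_top := hγ_top
      g_anti := fun n s t hst => by
        have := hΛprob n
        rw [hΛbar, hΛbar]
        exact ENNReal.toReal_mono (measure_ne_top _ _) (measure_mono (Ioi_subset_Ioi hst))
      g_nn := fun n t => by rw [hΛbar]; exact ENNReal.toReal_nonneg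
      g_le := fun n t => by
        have := hΛprob n
        rw [hΛbar]
        exact ENNReal.toReal_le_of_le_ofReal zero_le_one (by simpa using prob_le_one)
      g_dom := fun n t ht => hdom n t ht.le
      G_int := hG1.const_mul C₀
      tG_int := by
        have := hG2.const_mul C₀
        refine this.congr (Eventually.of_forall fun t => ?_)
        simp only; ring
      lim1 := by
        refine hγ_lim.congr fun n => ?_
        have := hΛprob n
        rw [hbareq, (layer1 (Λ n) (hΛsupp n) (hmom1 n)).2]
      lim2 := by
        refine hsec_lim.congr fun n => ?_
        have := hΛprob n
        rw [hbareq, (layer2 (Λ n) (hΛsupp n) (hmom2 n)).2] }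
  refine (S.main hlam_pos hlam_lim y hy hκ).congr' ?_
  filter_upwards [S.mid] with n hn
  have hgood := S.good n hn.1
  refine setIntegral_congr_fun measurableSet_Ioi fun t ht => ?_
  have ht' : 0 < γ n * t := mul_pos (hγ_pos n) ht
  show |_ - _| ^ (2 * κ) = |_ - _| ^ (2 * κ)
  rw [resolventK_eq hgood (R := Rβ n) (fun s hs => ?_) _ ht']
  rw [hRβ]
  refine resolvent_eq hgood (fun x hx => ?_) s hs
  unfold UU
  rw [indicator_of_mem (mem_Ioi.mpr hx), hΛbarβ]
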